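/- Let F be a field and let Ω be any eventually outward orientation of the D_∞ quiver. Then there does not exist an infinite sequence W_1, W_2, W_3, … of indecomposable FLEI representations of Ω over F together with morphisms W_1 → W_2 → W_3 → ⋯ each of which is nonzero and not an isomorphism. -/

import Mathlib

/-- A quiver: a set of vertices, a set of arrows, with source and target maps. -/
structure Quiv : Type 1 where
  V : Type
  A : Type
  s : A → V
  t : A → V

/-- A representation of a quiver over a field `F`. -/
structure QRep (F : Type) [Field F] (Q : Quiv) : Type 1 where
  M : Q.V → Type
  [acg : ∀ i, AddCommGroup (M i)]
  [mod : ∀ i, Module F (M i)]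
  map : ∀ a : Q.A, M (Q.s a) →ₗ[F] M (Q.t a)

attribute [instance] QRep.acg QRep.mod

namespace QRep

variable {F : Type} [Field F] {Q : Quiv}

/-- A representation is nonzero if some vertex space has a nonzero vector. -/
def Nonzero (V : QRep F Q) : Prop := ∃ i, ∃ x : V.M i, x ≠ 0

/-- A morphism of representations. -/
structure Hom (V W : QRep F Q) : Type where
  app : ∀ i, V.M i →ₗ[F] W.M i
  comm : ∀ a : Q.A, (W.map a).comp (app (Q.s a)) = (app (Q.t a)).comp (V.map a)

/-- A morphism is an isomorphism iff it is bijective at each vertex. -/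
def Hom.IsIso {V W : QRep F Q} (f : Hom V W) : Prop := ∀ i, Function.Bijective (f.app i)

/-- Two representations are isomorphic. -/
def Iso (V W : QRep F Q) : Prop := ∃ f : Hom V W, f.IsIso

/-- The (external) direct sum of two representations. -/
def dsum (V W : QRep F Q) : QRep F Q where
  M i := V.M i × W.M i
  map a := (V.map a).prodMap (W.map a)

/-- A representation is indecomposable if it is nonzero and not isomorphic to a direct
sum of two nonzero representations. -/
def Indec (V : QRep F Q) : Prop :=
  V.Nonzero ∧ ∀ A B : QRep F Q, A.Nonzero → B.Nonzero → ¬ Iso V (dsum A B)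

/-- FLEI: locally finite-dimensional, and all but finitely many arrow maps are
isomorphisms. -/
def IsFLEI (V : QRep F Q) : Prop :=
  (∀ i, FiniteDimensional F (V.M i)) ∧ {a : Q.A | ¬ Function.Bijective (V.map a)}.Finite

end QRep

/-- A subrepresentation: a subspace at each vertex, stable under the arrow maps. -/
structure Subrep {F : Type} [Field F] {Q : Quiv} (V : QRep F Q) : Type where
  S : ∀ i, Submodule F (V.M i)
  stable : ∀ a : Q.A, ∀ x ∈ S (Q.s a), V.map a x ∈ S (Q.t a)

namespace Subrep

variable {F : Type} [Field F] {Q : Quiv} {V : QRep F Q}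

/-- A subrepresentation, viewed as a representation in its own right. -/
def toRep (W : Subrep V) : QRep F Q where
  M i := ↥(W.S i)
  map a := (V.map a).restrict (W.stable a)

/-- The quotient of a representation by a subrepresentation. -/
def quot (W : Subrep V) : QRep F Q where
  M i := V.M i ⧸ W.S i
  map a := Submodule.mapQ _ _ (V.map a) (fun x hx => W.stable a x hx)

end Subrep
/-- Adjacency in the underlying graph of a quiver. -/
def Quiv.Adj (Q : Quiv) (i j : Q.V) : Prop :=
  ∃ a : Q.A, (Q.s a = i ∧ Q.t a = j) ∨ (Q.s a = j ∧ Q.t a = i)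

/-- The underlying graph is connected. -/
def Quiv.Connected (Q : Quiv) : Prop :=
  ∀ i j : Q.V, Relation.ReflTransGen Q.Adj i j

/-- Source of an oriented edge-traversal (arrow plus direction of traversal). -/
def Quiv.esrc (Q : Quiv) (p : Q.A × Bool) : Q.V := if p.2 then Q.s p.1 else Q.t p.1

/-- Target of an oriented edge-traversal. -/
def Quiv.etgt (Q : Quiv) (p : Q.A × Bool) : Q.V := if p.2 then Q.t p.1 else Q.s p.1

/-- `e 0, …, e (n-1)` is a cycle: a closed walk of positive length in the underlying
graph traversing no edge twice. -/
def Quiv.IsCycle (Q : Quiv) (n : ℕ) (e : ℕ → Q.A × Bool) : Prop :=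
  0 < n ∧ (∀ k < n, Q.etgt (e k) = Q.esrc (e ((k + 1) % n))) ∧
    (∀ j < n, ∀ k < n, (e j).1 = (e k).1 → j = k)

/-- The quiver has no cycles in its underlying graph. -/
def Quiv.NoCycles (Q : Quiv) : Prop := ¬ ∃ (n : ℕ) (e : ℕ → Q.A × Bool), Q.IsCycle n e

/-- A tree quiver: connected underlying graph with no cycles. -/
def Quiv.IsTree (Q : Quiv) : Prop := Q.Connected ∧ Q.NoCycles
/-- A journey in a quiver: a finite or infinite sequence of pairwise distinct vertices
`vert 0, vert 1, …` (up to index `len`, which may be `⊤`), consecutive vertices being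
joined by an arrow (in either direction). -/
structure Journey (Q : Quiv) : Type where
  len : ℕ∞
  vert : ℕ → Q.V
  edge : ∀ k : ℕ, (k : ℕ∞) < len → Q.A
  inj : ∀ m n : ℕ, (m : ℕ∞) ≤ len → (n : ℕ∞) ≤ len → vert m = vert n → m = n
  adj : ∀ (k : ℕ) (h : (k : ℕ∞) < len),
    (Q.s (edge k h) = vert k ∧ Q.t (edge k h) = vert (k + 1)) ∨
    (Q.s (edge k h) = vert (k + 1) ∧ Q.t (edge k h) = vert k)

/-- A quiver is eventually outward if every journey contains only finitely many arrows
pointing towards the start of the journey. -/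
def Quiv.EventuallyOutward (Q : Quiv) : Prop :=
  ∀ j : Journey Q,
    {k : ℕ | ∃ h : (k : ℕ∞) < j.len,
      Q.s (j.edge k h) = j.vert (k + 1) ∧ Q.t (j.edge k h) = j.vert k}.Finite

/-- A quiver is finitely branching if it is a union of finitely many journeys. -/
def Quiv.FinitelyBranching (Q : Quiv) : Prop :=
  ∃ (n : ℕ) (js : Fin n → Journey Q),
    (∀ v : Q.V, ∃ (m : Fin n) (k : ℕ), (k : ℕ∞) ≤ (js m).len ∧ (js m).vert k = v) ∧
    (∀ a : Q.A, ∃ (m : Fin n) (k : ℕ) (h : (k : ℕ∞) < (js m).len), (js m).edge k h = a)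
/-- Vertices of the `D∞` quiver: two leaves `x`, `y` and a long arm indexed by `ℕ`,
with `long 0` the trivalent vertex. -/
inductive DV : Type
  | x : DV
  | y : DV
  | long : ℕ → DV

/-- Edges of the `D∞` quiver: `ex` joins `x` and `long 0`, `ey` joins `y` and `long 0`,
and `el n` joins `long n` and `long (n+1)`. -/
inductive DE : Type
  | ex : DE
  | ey : DE
  | el : ℕ → DE

/-- One canonical endpoint of each edge of `D∞`. -/
def DE.endA : DE → DV
  | .ex => .x
  | .ey => .y
  | .el n => .long n

/-- The other canonical endpoint of each edge of `D∞`. -/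
def DE.endB : DE → DV
  | .ex => .long 0
  | .ey => .long 0
  | .el n => .long (n + 1)

/-- The `D∞` quiver with the orientation of each edge chosen by `o` (if `o e = true` the
arrow goes from `endA e` to `endB e`, otherwise the other way). -/
def Dinf (o : DE → Bool) : Quiv where
  V := DV
  A := DE
  s e := if o e then e.endA else e.endB
  t e := if o e then e.endB else e.endA

/-- The mountain `D∞` quiver: every arrow points away from the trivalent vertex
`long 0`. -/
def mountainD : Quiv where
  V := DV
  A := DE
  s e := match e with
    | .ex => .long 0
    | .ey => .long 0
    | .el n => .long n
  t e := match e with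
    | .ex => .x
    | .ey => .y
    | .el n => .long (n + 1)
namespace QRep

variable {F : Type} [Field F] {Q : Quiv}

/-- A morphism is nonzero if it is nonzero at some vertex. -/
def Hom.Nonzero {V W : QRep F Q} (f : Hom V W) : Prop := ∃ i, f.app i ≠ 0

/-- A morphism is injective if it is injective at every vertex. -/
def Hom.Injective {V W : QRep F Q} (f : Hom V W) : Prop :=
  ∀ i, Function.Injective (f.app i)

/-- A morphism is surjective if it is surjective at every vertex. -/
def Hom.Surjective {V W : QRep F Q} (f : Hom V W) : Prop :=
  ∀ i, Function.Surjective (f.app i)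

end QRep

/-! ### Filtered spaces with two distinguished subspaces -/

section Filtered

variable {F E E' D : Type} [Field F] [AddCommGroup E] [Module F E] [AddCommGroup E'] [Module F E']
  [LinearOrder D]

/-- `S` is the sum of its intersections with `P` and `H`. -/
def Splits (S P H : Submodule F E) : Prop := S ≤ (S ⊓ P) ⊔ (S ⊓ H)

theorem splits_of_le_right {S P H : Submodule F E} (h : S ≤ H) : Splits S P H :=
  (le_inf le_rfl h).trans le_sup_right

theorem splits_of_ge {S P H : Submodule F E} (hc : IsCompl P H) (h : P ≤ S) : Splits S P H := by
  intro s hs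
  have : s ∈ P ⊔ H := by rw [hc.sup_eq_top]; trivial
  obtain ⟨a, ha, b, hb, rfl⟩ := Submodule.mem_sup.1 this
  refine Submodule.add_mem_sup ⟨h ha, ha⟩ ⟨?_, hb⟩
  simpa using S.sub_mem hs (h ha)

theorem splits_bot {P H : Submodule F E} : Splits ⊥ P H := bot_le

theorem splits_top {P H : Submodule F E} (hc : IsCompl P H) : Splits ⊤ P H :=
  splits_of_ge hc le_top

theorem exists_isCompl_span_of_notMem {v : E} {U : Submodule F E} (h : v ∉ U) :
    ∃ H, U ≤ H ∧ IsCompl (Submodule.span F {v}) H := by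
  have hv : v ≠ 0 := fun h0 => h (h0 ▸ U.zero_mem)
  have hd : Disjoint U (Submodule.span F {v}) := (Submodule.disjoint_span_singleton' hv).2 h
  obtain ⟨H, hH, hc⟩ := hd.exists_isCompl
  exact ⟨H, hH, hc.symm⟩

theorem notMem_iSup_of_monotone {G : D → Submodule F E} (hG : Monotone G) {v : E} (hv : v ≠ 0) :
    v ∉ ⨆ d : {d : D // v ∉ G d}, G d := by
  intro h
  rcases isEmpty_or_nonempty {d : D // v ∉ G d} with he | he
  · rw [iSup_of_empty] at h
    exact hv h
  · have hdir : Directed (· ≤ ·) (fun d : {d : D // v ∉ G d} => G d) :=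
      (hG.comp (Subtype.mono_coe _)).directed_le
    obtain ⟨d, hd⟩ := (Submodule.mem_iSup_of_directed _ hdir).1 h
    exact d.2 hd

/-- A vector always spans a summand compatible with a chain of subspaces. -/
theorem exists_isCompl_span_splits {G : D → Submodule F E} (hG : Monotone G) {v : E}
    (hv : v ≠ 0) : ∃ H, IsCompl (Submodule.span F {v}) H ∧
      ∀ d, Splits (G d) (Submodule.span F {v}) H := by
  obtain ⟨H, hH, hc⟩ := exists_isCompl_span_of_notMem (notMem_iSup_of_monotone hG hv)
  refine ⟨H, hc, fun d => ?_⟩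
  by_cases h : v ∈ G d
  · exact splits_of_ge hc ((Submodule.span_singleton_le_iff_mem _ _).2 h)
  · exact splits_of_le_right ((le_iSup (fun d : {d : D // v ∉ G d} => G d) ⟨d, h⟩).trans hH)

/-- A proper subspace lies in a hyperplane with a complement compatible with a given chain. -/
theorem exists_isCompl_splits_of_ne_top [WellFoundedLT D] {G : D → Submodule F E} (hG : Monotone G)
    (hT : ∃ d, G d = ⊤) {I : Submodule F E} (hI : I ≠ ⊤) :
    ∃ v H, v ≠ 0 ∧ I ≤ H ∧ IsCompl (Submodule.span F {v}) H ∧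
      ∀ d, Splits (G d) (Submodule.span F {v}) H := by
  obtain ⟨H, hH, hIH⟩ := (eq_top_or_exists_le_coatom I).resolve_left hI
  have hne : {d | ¬ G d ≤ H}.Nonempty := by
    obtain ⟨d, hd⟩ := hT
    exact ⟨d, fun h => hH.1 (top_le_iff.1 (hd ▸ h))⟩
  obtain ⟨d, hd, hmin⟩ := WellFounded.has_min (wellFounded_lt (α := D)) _ hne
  obtain ⟨v, hvG, hvH⟩ := Set.not_subset.1 hd
  have hv : v ≠ 0 := fun h0 => hvH (h0 ▸ H.zero_mem)
  have hc : IsCompl (Submodule.span F {v}) H := by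
    refine ⟨((Submodule.disjoint_span_singleton' hv).2 hvH).symm, ?_⟩
    rw [codisjoint_iff]
    refine hH.2 _ (lt_of_le_of_ne le_sup_right fun h => hvH ?_)
    rw [h]
    exact Submodule.mem_sup_left (Submodule.mem_span_singleton_self v)
  refine ⟨v, H, hv, hIH, hc, fun e => ?_⟩
  by_cases he : G e ≤ H
  · exact splits_of_le_right he
  · have : d ≤ e := not_lt.1 (hmin e he)
    exact splits_of_ge hc ((Submodule.span_singleton_le_iff_mem _ _).2 (hG this hvG))

theorem finite_and_finrank_le_two {x y : E} (hs : Submodule.span F {x, y} = ⊤) :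
    Module.Finite F E ∧ Module.finrank F E ≤ 2 := by
  have hr : Set.range ![x, y] = {x, y} := by simp [Matrix.range_cons, Set.pair_comm]
  refine ⟨⟨hs ▸ Submodule.fg_span (Set.toFinite _)⟩, ?_⟩
  · rw [← finrank_top, ← hs, ← hr]
    exact (finrank_range_le_card _).trans (by simp)

/-- A nonzero space with two subspaces and a chain of subspaces, having no proper direct sum
decomposition. -/
structure FiltIndec (X Y : Submodule F E) (G : D → Submodule F E) : Prop where
  mono : Monotone G
  top : ∃ d, G d = ⊤
  nontriv : ∃ v : E, v ≠ 0
  split : ∀ P H, IsCompl P H → Splits X P H → Splits Y P H → (∀ d, Splits (G d) P H) →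
    P = ⊥ ∨ H = ⊥

theorem FiltIndec.span_eq_top {X Y : Submodule F E} {G : D → Submodule F E}
    (h : FiltIndec X Y G) {v : E} {H : Submodule F E} (hv : v ≠ 0)
    (hc : IsCompl (Submodule.span F {v}) H) (hX : Splits X (Submodule.span F {v}) H)
    (hY : Splits Y (Submodule.span F {v}) H) (hG : ∀ d, Splits (G d) (Submodule.span F {v}) H) :
    H = ⊥ ∧ Submodule.span F {v} = ⊤ := by
  have hH : H = ⊥ := (h.split _ _ hc hX hY hG).resolve_left
    (fun h0 => hv (Submodule.span_singleton_eq_bot.1 h0))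
  refine ⟨hH, ?_⟩
  have := hc.sup_eq_top
  rwa [hH, sup_bot_eq] at this

theorem FiltIndec.symm {X Y : Submodule F E} {G : D → Submodule F E} (h : FiltIndec X Y G) :
    FiltIndec Y X G :=
  ⟨h.mono, h.top, h.nontriv, fun P H hc hY hX hG => h.split P H hc hX hY hG⟩

theorem FiltIndec.of_sup_ne_top [WellFoundedLT D] {X Y : Submodule F E} {G : D → Submodule F E}
    (h : FiltIndec X Y G) (hs : X ⊔ Y ≠ ⊤) :
    X = ⊥ ∧ Y = ⊥ ∧ ∃ v : E, v ≠ 0 ∧ Submodule.span F {v} = ⊤ := by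
  obtain ⟨v, H, hv, hI, hc, hG⟩ := exists_isCompl_splits_of_ne_top h.mono h.top hs
  obtain ⟨hH, ht⟩ := h.span_eq_top hv hc (splits_of_le_right (le_sup_left.trans hI))
    (splits_of_le_right (le_sup_right.trans hI)) hG
  subst hH
  exact ⟨le_bot_iff.1 (le_sup_left.trans hI), le_bot_iff.1 (le_sup_right.trans hI), v, hv, ht⟩

theorem FiltIndec.of_inf_ne_bot {X Y : Submodule F E} {G : D → Submodule F E}
    (h : FiltIndec X Y G) (hs : X ⊓ Y ≠ ⊥) :
    X = ⊤ ∧ Y = ⊤ ∧ ∃ v : E, v ≠ 0 ∧ Submodule.span F {v} = ⊤ := by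
  obtain ⟨v, hvm, hv⟩ := Submodule.exists_mem_ne_zero_of_ne_bot hs
  obtain ⟨H, hc, hG⟩ := exists_isCompl_span_splits h.mono hv
  have hX := (Submodule.span_singleton_le_iff_mem (R := F) v X).2 hvm.1
  have hY := (Submodule.span_singleton_le_iff_mem (R := F) v Y).2 hvm.2
  obtain ⟨-, ht⟩ := h.span_eq_top hv hc (splits_of_ge hc hX) (splits_of_ge hc hY) hG
  rw [ht] at hX hY
  exact ⟨top_le_iff.1 hX, top_le_iff.1 hY, v, hv, ht⟩

variable [WellFoundedLT D] [Nonempty D]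

open Classical in
/-- The least element of a set in a well order, with a default value for the empty set. -/
noncomputable def least (S : Set D) : D :=
  if h : S.Nonempty then (wellFounded_lt (α := D)).min S h else Classical.arbitrary D

theorem least_mem {S : Set D} (h : S.Nonempty) : least S ∈ S := by
  rw [least, dif_pos h]
  exact WellFounded.min_mem _ _ _

theorem least_le {S : Set D} {d : D} (h : d ∈ S) : least S ≤ d := by
  rw [least, dif_pos ⟨d, h⟩]
  exact not_lt.1 (WellFounded.not_lt_min _ _ h)

/-- The first index at which the chain is nonzero. -/
noncomputable def firstNe (G : D → Submodule F E) : D := least {d | G d ≠ ⊥}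

/-- The first index at which the chain is everything. -/
noncomputable def firstTop (G : D → Submodule F E) : D := least {d | G d = ⊤}

open Classical in
/-- A coarse numerical type of a pair of subspaces. -/
noncomputable def pairType (X Y : Submodule F E) : ℕ :=
  if X ⊔ Y ≠ ⊤ then 2 else if X ⊓ Y = ⊥ then 1 else 0

namespace FiltIndec

variable {X Y : Submodule F E} {G : D → Submodule F E} {X' Y' : Submodule F E'}
  {G' : D → Submodule F E'}

theorem apply_ne_bot_iff (h : FiltIndec X Y G) {d : D} : G d ≠ ⊥ ↔ firstNe G ≤ d := by
  have hne : {d | G d ≠ ⊥}.Nonempty := by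
    obtain ⟨d, hd⟩ := h.top
    obtain ⟨v, hv⟩ := h.nontriv
    refine ⟨d, fun hb => hv ?_⟩
    have : v ∈ (⊥ : Submodule F E) := by rw [← hb, hd]; trivial
    simpa using this
  refine ⟨fun hd => least_le hd, fun hd hb => least_mem hne ?_⟩
  exact le_bot_iff.1 ((h.mono hd).trans hb.le)

theorem apply_eq_top_iff (h : FiltIndec X Y G) {d : D} : G d = ⊤ ↔ firstTop G ≤ d := by
  have hne : {d | G d = ⊤}.Nonempty := h.top
  refine ⟨fun hd => least_le hd, fun hd => ?_⟩
  have h1 : G (firstTop G) = ⊤ := least_mem hne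
  exact top_le_iff.1 (h1.ge.trans (h.mono hd))

theorem of_mem_left (h : FiltIndec X Y G) (h1 : X ⊓ Y = ⊥)
    {v : E} (hv : v ≠ 0) (hvX : v ∈ X) (hvG : v ∈ G (firstNe G)) :
    X = ⊤ ∧ Submodule.span F {v} = ⊤ := by
  have hvY : v ∉ Y := fun hY => hv (by
    have : v ∈ X ⊓ Y := ⟨hvX, hY⟩
    simpa [h1] using this)
  obtain ⟨H, hH, hc⟩ := exists_isCompl_span_of_notMem hvY
  have hX := (Submodule.span_singleton_le_iff_mem (R := F) v X).2 hvX
  obtain ⟨-, ht⟩ := h.span_eq_top hv hc (splits_of_ge hc hX) (splits_of_le_right hH) (fun d => by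
    by_cases hd : G d = ⊥
    · rw [hd]; exact splits_bot
    · exact splits_of_ge hc ((Submodule.span_singleton_le_iff_mem _ _).2
        (h.mono (h.apply_ne_bot_iff.1 hd) hvG)))
  rw [ht] at hX
  exact ⟨top_le_iff.1 hX, ht⟩

theorem span_pair_eq_top (h : FiltIndec X Y G) (h1 : X ⊓ Y = ⊥) (h2 : X ⊔ Y = ⊤)
    (hX : G (firstNe G) ⊓ X = ⊥) {x y : E} (hx : x ∈ X) (hy : y ∈ Y)
    (hx0 : x ≠ 0) (hxy : x + y ∈ G (firstNe G)) : Submodule.span F {x, y} = ⊤ := by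
  have hxU := notMem_iSup_of_monotone h.mono hx0
  obtain ⟨ψ₀, hψ0, hψ₀U⟩ := Submodule.exists_le_ker_of_notMem hxU
  obtain ⟨ψ, hψx, hψU⟩ : ∃ ψ : E →ₗ[F] F, ψ x = 1 ∧ ∀ d, x ∉ G d → ∀ e ∈ G d, ψ e = 0 := by
    refine ⟨(ψ₀ x)⁻¹ • ψ₀, by simp [hψ0], fun d hd e he => ?_⟩
    have : ψ₀ e = 0 :=
      hψ₀U (le_iSup (fun d : {d : D // x ∉ G d} => G d) ⟨d, hd⟩ he)
    simp [this]
  have hxp : x ∉ G (firstNe G) := fun hxG => hx0 (by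
    have : x ∈ G (firstNe G) ⊓ X := ⟨hxG, hx⟩
    simpa [hX] using this)
  have hψy : ψ y = -1 := by
    have := hψU _ hxp _ hxy
    rw [map_add, hψx] at this
    linear_combination this
  have hdec : ∀ e : E, ∃ a ∈ X, ∃ b ∈ Y, a + b = e := fun e =>
    Submodule.mem_sup.1 (by rw [h2]; trivial)
  have hzero : ∀ a ∈ X, ∀ b ∈ Y, a + b = 0 → a = 0 ∧ b = 0 := by
    intro a ha b hb hab
    have h3 : a ∈ X ⊓ Y := ⟨ha, by rw [eq_neg_of_add_eq_zero_left hab]; exact Y.neg_mem hb⟩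
    have h4 : a = 0 := by simpa [h1] using h3
    subst h4
    exact ⟨rfl, by simpa using hab⟩
  set P := Submodule.span F {x, y} with hP
  set H := (X ⊓ LinearMap.ker ψ) ⊔ (Y ⊓ LinearMap.ker ψ) with hH
  have hxP : x ∈ P := Submodule.subset_span (by simp)
  have hyP : y ∈ P := Submodule.subset_span (by simp)
  have hHX : ∀ a ∈ X, a - ψ a • x ∈ X ∧ a - ψ a • x ∈ H := by
    intro a ha
    have h3 := X.sub_mem ha (X.smul_mem (ψ a) hx)
    exact ⟨h3, Submodule.mem_sup_left ⟨h3, by simp [hψx]⟩⟩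
  have hHY : ∀ b ∈ Y, b + ψ b • y ∈ Y ∧ b + ψ b • y ∈ H := by
    intro a ha
    have h3 := Y.add_mem ha (Y.smul_mem (ψ a) hy)
    exact ⟨h3, Submodule.mem_sup_right ⟨h3, by simp [hψy]⟩⟩
  have hc : IsCompl P H := by
    constructor
    · rw [Submodule.disjoint_def]
      intro e heP heH
      obtain ⟨a, b, rfl⟩ := Submodule.mem_span_pair.1 heP
      obtain ⟨c, ⟨hcX, hcψ⟩, d, ⟨hdY, hdψ⟩, hcd⟩ := Submodule.mem_sup.1 heH
      rw [SetLike.mem_coe, LinearMap.mem_ker] at hcψ hdψ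
      obtain ⟨h3, h4⟩ := hzero (c - a • x) (X.sub_mem hcX (X.smul_mem _ hx))
        (d - b • y) (Y.sub_mem hdY (Y.smul_mem _ hy))
        (by rw [← sub_eq_zero] at hcd; rw [← hcd]; abel)
      have h5 := congrArg ψ h3
      have h6 := congrArg ψ h4
      simp only [map_sub, map_smul, hcψ, hdψ, hψx, hψy, smul_eq_mul, map_zero] at h5 h6
      have ha : a = 0 := by linear_combination -h5
      have hb : b = 0 := by linear_combination h6
      simp [ha, hb]
    · rw [codisjoint_iff, eq_top_iff]
      intro e _
      obtain ⟨a, ha, b, hb, rfl⟩ := hdec e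
      have : a + b = (ψ a • x + -ψ b • y) + ((a - ψ a • x) + (b + ψ b • y)) := by
        rw [neg_smul]; abel
      rw [this]
      exact Submodule.add_mem_sup (P.add_mem (P.smul_mem _ hxP) (P.smul_mem _ hyP))
        (H.add_mem (hHX a ha).2 (hHY b hb).2)
  have hsX : Splits X P H := by
    intro a ha
    have : a = ψ a • x + (a - ψ a • x) := by abel
    rw [this]
    exact Submodule.add_mem_sup ⟨X.smul_mem _ hx, P.smul_mem _ hxP⟩ (hHX a ha)
  have hsY : Splits Y P H := by
    intro b hb
    have : b = -ψ b • y + (b + ψ b • y) := by rw [neg_smul]; abel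
    rw [this]
    exact Submodule.add_mem_sup ⟨Y.smul_mem _ hy, P.smul_mem _ hyP⟩ (hHY b hb)
  have hsG : ∀ d, Splits (G d) P H := by
    intro d
    by_cases hd : G d = ⊥
    · rw [hd]; exact splits_bot
    have hvd := h.mono (h.apply_ne_bot_iff.1 hd) hxy
    by_cases hxd : x ∈ G d
    · refine splits_of_ge hc (Submodule.span_le.2 ?_)
      rintro z (rfl | rfl)
      · exact hxd
      · simpa using (G d).sub_mem hvd hxd
    · intro e he
      have hψe := hψU d hxd e he
      obtain ⟨a, ha, b, hb, rfl⟩ := hdec e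
      have hψb : ψ b = - ψ a := by
        rw [map_add] at hψe
        linear_combination hψe
      have h3 : a + b - ψ a • (x + y) = (a - ψ a • x) + (b + ψ b • y) := by
        rw [hψb, smul_add, neg_smul]; abel
      have h4 : a + b = ψ a • (x + y) + (a + b - ψ a • (x + y)) := by abel
      rw [h4]
      refine Submodule.add_mem_sup ⟨(G d).smul_mem _ hvd, P.smul_mem _ (P.add_mem hxP hyP)⟩
        ⟨(G d).sub_mem he ((G d).smul_mem _ hvd), ?_⟩
      rw [h3]
      exact H.add_mem (hHX a ha).2 (hHY b hb).2
  have hHb : H = ⊥ := (h.split P H hc hsX hsY hsG).resolve_left (fun h0 => hx0 (by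
    simpa [h0] using hxP))
  have := hc.sup_eq_top
  rwa [hHb, sup_bot_eq] at this

theorem of_pair (h : FiltIndec X Y G) (h1 : X ⊓ Y = ⊥) (h2 : X ⊔ Y = ⊤) :
    (G (firstNe G) = ⊤ ∧ (X = ⊤ ∨ Y = ⊤) ∧ ∃ v : E, v ≠ 0 ∧ Submodule.span F {v} = ⊤) ∨
    (G (firstNe G) ⊓ X = ⊥ ∧ G (firstNe G) ⊓ Y = ⊥ ∧ ∃ x ∈ X, ∃ y ∈ Y, x ≠ 0 ∧ y ≠ 0 ∧
      x + y ∈ G (firstNe G) ∧ Submodule.span F {x, y} = ⊤) := by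
  by_cases hX : G (firstNe G) ⊓ X = ⊥
  · by_cases hY : G (firstNe G) ⊓ Y = ⊥
    · right
      refine ⟨hX, hY, ?_⟩
      obtain ⟨v, hv, hv0⟩ := Submodule.exists_mem_ne_zero_of_ne_bot (h.apply_ne_bot_iff.2 le_rfl)
      obtain ⟨x, hx, y, hy, rfl⟩ := Submodule.mem_sup.1 (show v ∈ X ⊔ Y by rw [h2]; trivial)
      have hx0 : x ≠ 0 := by
        rintro rfl
        rw [zero_add] at hv hv0
        have : y ∈ G (firstNe G) ⊓ Y := ⟨hv, hy⟩
        exact hv0 (by simpa [hY] using this)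
      have hy0 : y ≠ 0 := by
        rintro rfl
        rw [add_zero] at hv hv0
        have : x ∈ G (firstNe G) ⊓ X := ⟨hv, hx⟩
        exact hv0 (by simpa [hX] using this)
      exact ⟨x, hx, y, hy, hx0, hy0, hv, h.span_pair_eq_top h1 h2 hX hx hy hx0 hv⟩
    · left
      obtain ⟨v, hv, hv0⟩ := Submodule.exists_mem_ne_zero_of_ne_bot hY
      obtain ⟨ht, hs⟩ := h.symm.of_mem_left (by rwa [inf_comm]) hv0 hv.2 hv.1
      refine ⟨?_, Or.inr ht, v, hv0, hs⟩
      rw [← top_le_iff, ← hs, Submodule.span_singleton_le_iff_mem]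
      exact hv.1
  · left
    obtain ⟨v, hv, hv0⟩ := Submodule.exists_mem_ne_zero_of_ne_bot hX
    obtain ⟨ht, hs⟩ := h.of_mem_left h1 hv0 hv.2 hv.1
    refine ⟨?_, Or.inl ht, v, hv0, hs⟩
    rw [← top_le_iff, ← hs, Submodule.span_singleton_le_iff_mem]
    exact hv.1

theorem apply_firstNe_eq_top (h : FiltIndec X Y G) {v : E} (hs : Submodule.span F {v} = ⊤) :
    G (firstNe G) = ⊤ := by
  obtain ⟨w, hw, hw0⟩ := Submodule.exists_mem_ne_zero_of_ne_bot (h.apply_ne_bot_iff.2 le_rfl)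
  obtain ⟨c, rfl⟩ := Submodule.mem_span_singleton.1 (show w ∈ Submodule.span F {v} by
    rw [hs]; trivial)
  have hc : c ≠ 0 := by rintro rfl; simp at hw0
  rw [← top_le_iff, ← hs, Submodule.span_singleton_le_iff_mem]
  simpa [hc] using (G (firstNe G)).smul_mem c⁻¹ hw

theorem exists_span_pair (h : FiltIndec X Y G) : ∃ x y : E, Submodule.span F {x, y} = ⊤ := by
  by_cases h2 : X ⊔ Y = ⊤
  · by_cases h1 : X ⊓ Y = ⊥
    · obtain ⟨-, -, v, -, hv⟩ | ⟨-, -, x, -, y, -, -, -, -, hxy⟩ := h.of_pair h1 h2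
      · exact ⟨v, v, by simpa using hv⟩
      · exact ⟨x, y, hxy⟩
    · obtain ⟨-, -, v, -, hv⟩ := h.of_inf_ne_bot h1
      exact ⟨v, v, by simpa using hv⟩
  · obtain ⟨-, -, v, -, hv⟩ := h.of_sup_ne_top h2
    exact ⟨v, v, by simpa using hv⟩

section Morphism

variable {f : E →ₗ[F] E'}

theorem injective_of_span (hf : f ≠ 0) {v : E} (hs : Submodule.span F {v} = ⊤) :
    Function.Injective f := by
  have hfv : f v ≠ 0 := fun h0 => hf (LinearMap.ext_on (s := {v}) hs (by simp [h0]))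
  rw [injective_iff_map_eq_zero]
  intro w hw
  obtain ⟨c, rfl⟩ := Submodule.mem_span_singleton.1 (show w ∈ Submodule.span F {v} by
    rw [hs]; trivial)
  rw [map_smul, smul_eq_zero_iff_left hfv] at hw
  simp [hw]

theorem bijective_of_span (hf : f ≠ 0) {v : E} (hs : Submodule.span F {v} = ⊤)
    {v' : E'} (hs' : Submodule.span F {v'} = ⊤) : Function.Bijective f := by
  refine ⟨injective_of_span hf hs, fun w => ?_⟩
  have hfv : f v ≠ 0 := fun h0 => hf (LinearMap.ext_on (s := {v}) hs (by simp [h0]))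
  obtain ⟨c, hc⟩ := Submodule.mem_span_singleton.1 (show f v ∈ Submodule.span F {v'} by
    rw [hs']; trivial)
  obtain ⟨d, hd⟩ := Submodule.mem_span_singleton.1 (show w ∈ Submodule.span F {v'} by
    rw [hs']; trivial)
  have hc0 : c ≠ 0 := by rintro rfl; simp at hc; exact hfv hc.symm
  refine ⟨(d * c⁻¹) • v, ?_⟩
  rw [map_smul, ← hc, ← hd, smul_smul, mul_assoc, inv_mul_cancel₀ hc0, mul_one]

omit [Nonempty D] in
theorem pairType_le (hX : ∀ v ∈ X, f v ∈ X') (hY : ∀ v ∈ Y, f v ∈ Y')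
    (h : FiltIndec X Y G) (h' : FiltIndec X' Y' G') (hf : f ≠ 0) :
    pairType X' Y' ≤ pairType X Y := by
  unfold pairType
  by_cases h2 : X ⊔ Y = ⊤
  · have h2' : X' ⊔ Y' = ⊤ := by
      by_contra hne
      obtain ⟨rfl, rfl, -⟩ := h'.of_sup_ne_top hne
      refine hf (LinearMap.ext fun v => ?_)
      obtain ⟨x, hx, y, hy, rfl⟩ := Submodule.mem_sup.1 (show v ∈ X ⊔ Y by rw [h2]; trivial)
      have h3 := hX x hx
      have h4 := hY y hy
      rw [Submodule.mem_bot] at h3 h4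
      simp [h3, h4]
    rw [if_neg (not_not.2 h2), if_neg (not_not.2 h2')]
    by_cases h1 : X ⊓ Y = ⊥
    · rw [if_pos h1]
      split_ifs <;> omega
    · obtain ⟨rfl, rfl, -⟩ := h.of_inf_ne_bot h1
      rw [if_neg h1, if_neg]
      intro h3
      refine hf (LinearMap.ext fun v => ?_)
      have : f v ∈ X' ⊓ Y' := ⟨hX v trivial, hY v trivial⟩
      simpa [h3] using this
  · rw [if_pos h2]
    split_ifs <;> omega

theorem pairType_eq_one_iff : pairType X Y = 1 ↔ X ⊔ Y = ⊤ ∧ X ⊓ Y = ⊥ := by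
  unfold pairType
  split_ifs <;> simp_all

omit [Nonempty D] in
theorem exists_span_of_pairType_ne_one (h : FiltIndec X Y G) (hp : pairType X Y ≠ 1) :
    ∃ v : E, v ≠ 0 ∧ Submodule.span F {v} = ⊤ := by
  by_cases h2 : X ⊔ Y = ⊤
  · by_cases h1 : X ⊓ Y = ⊥
    · exact absurd (pairType_eq_one_iff.2 ⟨h2, h1⟩) hp
    · exact (h.of_inf_ne_bot h1).2.2
  · exact (h.of_sup_ne_top h2).2.2

theorem eq_zero_of_add {x y : E} (h1 : X ⊓ Y = ⊥) (hx : x ∈ X) (hy : y ∈ Y) (h : x + y = 0) :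
    x = 0 ∧ y = 0 := by
  have h3 : x ∈ X ⊓ Y := ⟨hx, by rw [eq_neg_of_add_eq_zero_left h]; exact Y.neg_mem hy⟩
  have h4 : x = 0 := by simpa [h1] using h3
  subst h4
  exact ⟨rfl, by simpa using h⟩

theorem exists_apply_ne_zero (hX : ∀ v ∈ X, f v ∈ X') (hY : ∀ v ∈ Y, f v ∈ Y')
    (h : FiltIndec X Y G) (hf : f ≠ 0)
    (hp : pairType X' Y' = pairType X Y) : ∃ v ∈ G (firstNe G), f v ≠ 0 := by
  have key : G (firstNe G) = ⊤ → ∃ v ∈ G (firstNe G), f v ≠ 0 := by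
    intro ht
    by_contra! hv
    exact hf (LinearMap.ext fun v => hv v (by rw [ht]; trivial))
  by_cases hp1 : pairType X Y = 1
  · have hp1' := hp.trans hp1
    rw [pairType_eq_one_iff] at hp1 hp1'
    obtain ⟨ht, -⟩ | ⟨-, -, x, hx, y, hy, hx0, hy0, hxy, hs⟩ := h.of_pair hp1.2 hp1.1
    · exact key ht
    · refine ⟨_, hxy, fun h0 => hf ?_⟩
      rw [map_add] at h0
      obtain ⟨h3, h4⟩ := eq_zero_of_add hp1'.2 (hX x hx) (hY y hy) h0
      refine LinearMap.ext_on (s := {x, y}) hs ?_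
      rintro z (rfl | rfl)
      · exact h3
      · exact h4
  · obtain ⟨v, -, hv⟩ := h.exists_span_of_pairType_ne_one hp1
    exact key (h.apply_firstNe_eq_top hv)

theorem firstNe_le (hX : ∀ v ∈ X, f v ∈ X') (hY : ∀ v ∈ Y, f v ∈ Y')
    (hG : ∀ d, ∀ v ∈ G d, f v ∈ G' d) (h : FiltIndec X Y G) (h' : FiltIndec X' Y' G') (hf : f ≠ 0)
    (hp : pairType X' Y' = pairType X Y) : firstNe G' ≤ firstNe G := by
  obtain ⟨v, hv, hfv⟩ := exists_apply_ne_zero hX hY h hf hp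
  exact h'.apply_ne_bot_iff.1 ((Submodule.ne_bot_iff _).2 ⟨_, hG _ v hv, hfv⟩)

theorem bijective_or_firstTop_lt (hX : ∀ v ∈ X, f v ∈ X') (hY : ∀ v ∈ Y, f v ∈ Y')
    (hG : ∀ d, ∀ v ∈ G d, f v ∈ G' d) (h : FiltIndec X Y G) (h' : FiltIndec X' Y' G') (hf : f ≠ 0)
    (hp : pairType X' Y' = pairType X Y) (hn : firstNe G' = firstNe G) :
    Function.Bijective f ∨ firstTop G' < firstTop G := by
  by_cases hp1 : pairType X Y = 1
  · have hp1' := hp.trans hp1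
    rw [pairType_eq_one_iff] at hp1 hp1'
    have hG0 := hG (firstNe G)
    obtain ⟨ht, hXY, v, hv0, hs⟩ | ⟨hGX, -, x, hx, y, hy, hx0, hy0, hxy, hs⟩ :=
      h.of_pair hp1.2 hp1.1
    · obtain ⟨-, -, v', -, hs'⟩ | ⟨hGX', hGY', -⟩ := h'.of_pair hp1'.2 hp1'.1
      · exact Or.inl (bijective_of_span hf hs hs')
      · exfalso
        rw [hn] at hGX' hGY'
        refine hf (LinearMap.ext fun w => ?_)
        have hw := hG0 w (by rw [ht]; trivial)
        rcases hXY with rfl | rfl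
        · have : f w ∈ G' (firstNe G) ⊓ X' := ⟨hw, hX w trivial⟩
          simpa [hGX'] using this
        · have : f w ∈ G' (firstNe G) ⊓ Y' := ⟨hw, hY w trivial⟩
          simpa [hGY'] using this
    · obtain ⟨ht', -⟩ | ⟨hGX', hGY', x', -, y', -, -, -, -, hs'⟩ := h'.of_pair hp1'.2 hp1'.1
      · right
        rw [← not_le, ← h.apply_eq_top_iff]
        intro ht
        have h3 := h'.apply_eq_top_iff.1 ht'
        have h4 : firstNe G' = firstTop G' := by
          refine le_antisymm (h'.apply_ne_bot_iff.1 ?_) h3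
          intro hb
          have h5 : G' (firstTop G') = ⊤ := h'.apply_eq_top_iff.2 le_rfl
          refine hf (LinearMap.ext fun w => ?_)
          have : f w ∈ G' (firstTop G') := by rw [h5]; trivial
          simpa [hb] using this
        rw [← h4, hn] at ht
        rw [ht, top_inf_eq] at hGX
        rw [hGX] at hx
        exact hx0 (by simpa using hx)
      · left
        rw [hn] at hGX' hGY'
        have hfxy := hG0 _ hxy
        rw [map_add] at hfxy
        have hne : ¬ (f x = 0 ∧ f y = 0) := by
          rintro ⟨h3, h4⟩
          refine hf (LinearMap.ext_on (s := {x, y}) hs ?_)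
          rintro z (rfl | rfl)
          · exact h3
          · exact h4
        have hfx : f x ≠ 0 := by
          intro h0
          rw [h0, zero_add] at hfxy
          have : f y ∈ G' (firstNe G) ⊓ Y' := ⟨hfxy, hY y hy⟩
          exact hne ⟨h0, by simpa [hGY'] using this⟩
        have hfy : f y ≠ 0 := by
          intro h0
          rw [h0, add_zero] at hfxy
          have : f x ∈ G' (firstNe G) ⊓ X' := ⟨hfxy, hX x hx⟩
          exact hne ⟨by simpa [hGX'] using this, h0⟩
        have hinj : Function.Injective f := by
          rw [injective_iff_map_eq_zero]
          intro w hw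
          obtain ⟨a, b, rfl⟩ := Submodule.mem_span_pair.1 (show w ∈ Submodule.span F {x, y} by
            rw [hs]; trivial)
          rw [map_add] at hw
          obtain ⟨h3, h4⟩ := eq_zero_of_add hp1'.2 (hX _ (X.smul_mem a hx))
            (hY _ (Y.smul_mem b hy)) hw
          rw [map_smul, smul_eq_zero_iff_left hfx] at h3
          rw [map_smul, smul_eq_zero_iff_left hfy] at h4
          simp [h3, h4]
        refine ⟨hinj, ?_⟩
        have hli : LinearIndependent F ![f x, f y] := by
          rw [LinearIndependent.pair_iff]
          intro a b hab
          obtain ⟨h3, h4⟩ := eq_zero_of_add hp1'.2 (X'.smul_mem a (hX _ hx))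
            (Y'.smul_mem b (hY _ hy)) hab
          exact ⟨(smul_eq_zero_iff_left hfx).1 h3, (smul_eq_zero_iff_left hfy).1 h4⟩
        have hfin := (finite_and_finrank_le_two hs').2
        have := (finite_and_finrank_le_two hs').1
        have hcard : Fintype.card (Fin 2) = Module.finrank F E' :=
          le_antisymm hli.fintype_card_le_finrank (by simpa using hfin)
        have htop := hli.span_eq_top_of_card_eq_finrank hcard
        rw [← LinearMap.range_eq_top, ← top_le_iff, ← htop, Submodule.span_le]
        rintro z ⟨i, rfl⟩
        fin_cases i
        · exact ⟨x, rfl⟩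
        · exact ⟨y, rfl⟩
  · obtain ⟨v, -, hv⟩ := h.exists_span_of_pairType_ne_one hp1
    obtain ⟨v', -, hv'⟩ := h'.exists_span_of_pairType_ne_one (hp ▸ hp1)
    exact Or.inl (bijective_of_span hf hv hv')

theorem firstTop_le (hG : ∀ d, ∀ v ∈ G d, f v ∈ G' d) (h : FiltIndec X Y G)
    (h' : FiltIndec X' Y' G') (hf : Function.Surjective f) : firstTop G' ≤ firstTop G := by
  rw [← h'.apply_eq_top_iff, eq_top_iff]
  intro w _
  obtain ⟨v, rfl⟩ := hf w
  exact hG _ v (by rw [h.apply_eq_top_iff.2 le_rfl]; trivial)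

omit [Nonempty D] in
theorem mem_left_of_apply_mem (hX : ∀ v ∈ X, f v ∈ X') (hY : ∀ v ∈ Y, f v ∈ Y')
    (h : FiltIndec X Y G) (h' : FiltIndec X' Y' G') (hf : Function.Injective f)
    (hp : pairType X' Y' = pairType X Y) {v : E} (hv : f v ∈ X') : v ∈ X := by
  by_cases h2 : X ⊔ Y = ⊤
  · by_cases h1 : X ⊓ Y = ⊥
    · have hp1' := hp.trans (pairType_eq_one_iff.2 ⟨h2, h1⟩)
      rw [pairType_eq_one_iff] at hp1'
      obtain ⟨x, hx, y, hy, rfl⟩ := Submodule.mem_sup.1 (show v ∈ X ⊔ Y by rw [h2]; trivial)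
      have h3 : f y ∈ X' ⊓ Y' := ⟨by simpa using X'.sub_mem hv (hX x hx), hY y hy⟩
      rw [hp1'.2, Submodule.mem_bot] at h3
      have h4 : y = 0 := hf (by simpa using h3)
      simpa [h4] using hx
    · rw [(h.of_inf_ne_bot h1).1]
      trivial
  · have h2' : X' ⊔ Y' ≠ ⊤ := by
      intro h3
      simp only [pairType, h3] at hp
      split_ifs at hp <;> simp_all
    rw [(h'.of_sup_ne_top h2').1, Submodule.mem_bot] at hv
    rw [show v = 0 from hf (by simpa using hv)]
    exact X.zero_mem

theorem pairType_comm (X Y : Submodule F E) : pairType X Y = pairType Y X := by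
  rw [pairType, pairType, sup_comm, inf_comm]

theorem mem_chain_of_apply_mem
    (hG : ∀ d, ∀ v ∈ G d, f v ∈ G' d) (h : FiltIndec X Y G)
    (h' : FiltIndec X' Y' G') (hf : Function.Bijective f)
    (hn : firstNe G' = firstNe G) (ht : firstTop G' = firstTop G) {d : D} {v : E}
    (hv : f v ∈ G' d) : v ∈ G d := by
  by_cases h1 : G' d = ⊤
  · rw [h'.apply_eq_top_iff, ht, ← h.apply_eq_top_iff] at h1
    rw [h1]; trivial
  by_cases h2 : G' d = ⊥
  · rw [h2, Submodule.mem_bot] at hv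
    rw [show v = 0 from hf.1 (by simpa using hv)]
    exact (G d).zero_mem
  have h3 : G d ≠ ⊥ := by
    rw [← ne_eq, h'.apply_ne_bot_iff, hn, ← h.apply_ne_bot_iff] at h2
    exact h2
  obtain ⟨x', y', hs'⟩ := h'.exists_span_pair
  obtain ⟨hfin, hrank⟩ := finite_and_finrank_le_two hs'
  have hlt := Submodule.finrank_lt h1
  have hmap : (G d).map f ≤ G' d := Submodule.map_le_iff_le_comap.2 (hG d)
  obtain ⟨w, hw, hw0⟩ := Submodule.exists_mem_ne_zero_of_ne_bot h3
  have hpos : (G d).map f ≠ ⊥ := (Submodule.ne_bot_iff _).2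
    ⟨f w, ⟨w, hw, rfl⟩, (map_ne_zero_iff f hf.1).2 hw0⟩
  have := Submodule.one_le_finrank_iff.2 hpos
  rw [← Submodule.eq_of_le_of_finrank_le hmap (by omega)] at hv
  obtain ⟨w, hw, hwv⟩ := hv
  rwa [← hf.1 hwv]

end Morphism

end FiltIndec

end Filtered
/-! ### The rooted tree underlying the `D∞` quiver -/

/-- The endpoint of an edge closer to the trivalent vertex. -/
def DE.par : DE → DV
  | .ex => .long 0
  | .ey => .long 0
  | .el n => .long n

/-- The endpoint of an edge further away from the trivalent vertex. -/
def DE.child : DE → DV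
  | .ex => .x
  | .ey => .y
  | .el n => .long (n + 1)

/-- `r.Below i` says that the path from the trivalent vertex to `i` goes through `r`. -/
def DV.Below : DV → DV → Prop
  | .long m, .long n => m ≤ n
  | .long m, .x => m = 0
  | .long m, .y => m = 0
  | .x, .x => True
  | .y, .y => True
  | _, _ => False

namespace DV

theorem below_refl (r : DV) : r.Below r := by
  cases r <;> simp [Below]

theorem below_child_iff {r : DV} {e : DE} : r.Below e.child ↔ r = e.child ∨ r.Below e.par := by
  cases r <;> cases e <;> simp [Below, DE.child, DE.par]
  omega

theorem ne_child {r : DV} {e : DE} (h : r.Below e.par) : r ≠ e.child := by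
  rintro rfl
  cases e <;> simp [Below, DE.child, DE.par] at h

theorem Below.child {r : DV} {e : DE} (h : r.Below e.par) : r.Below e.child :=
  below_child_iff.2 (Or.inr h)

theorem long_zero_below (i : DV) : (long 0).Below i := by
  cases i <;> simp [Below]

theorem Below.induction {r : DV} {p : DV → Prop} (base : p r)
    (step : ∀ e : DE, r.Below e.par → p e.par → p e.child) (i : DV) (h : r.Below i) : p i := by
  have hl : ∀ n, r.Below (long n) → p (long n) := by
    intro n
    induction n with
    | zero =>
      intro h
      cases r <;> simp [Below] at h
      subst h
      exact base
    | succ n ih =>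
      intro h
      rcases (below_child_iff (e := .el n)).1 h with h | h
      · exact (show r = long (n + 1) from h) ▸ base
      · exact step (.el n) h (ih h)
  cases i with
  | long n => exact hl n h
  | x =>
    rcases (below_child_iff (e := .ex)).1 h with h | h
    · exact (show r = x from h) ▸ base
    · exact step .ex h (hl 0 h)
  | y =>
    rcases (below_child_iff (e := .ey)).1 h with h | h
    · exact (show r = y from h) ▸ base
    · exact step .ey h (hl 0 h)

/-- A vertex strictly below another one is the far end of an edge. -/
theorem Below.exists_edge {r s : DV} (h : r.Below s) (hne : r ≠ s) :
    ∃ e : DE, s = e.child ∧ r.Below e.par := by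
  revert hne
  refine Below.induction (p := fun s => r ≠ s → ∃ e : DE, s = e.child ∧ r.Below e.par)
    (fun h => absurd rfl h) (fun e he _ _ => ⟨e, rfl, he⟩) s h

theorem Below.trans {r s t : DV} (h : r.Below s) (h' : s.Below t) : r.Below t := by
  cases r <;> cases s <;> cases t <;> simp_all [Below]
  omega

theorem below_total {r s i : DV} (hr : r.Below i) (hs : s.Below i) : r.Below s ∨ s.Below r := by
  cases r <;> cases s <;> cases i <;> simp_all [Below]
  omega

end DV

/-! ### Propagating vectors along the tree -/

section Tree

variable {F : Type} [Field F] {M : DV → Type} [∀ i, AddCommGroup (M i)] [∀ i, Module F (M i)]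
  {N : DV → Type} [∀ i, AddCommGroup (N i)] [∀ i, Module F (N i)]

/-- The composition of two linear relations. -/
def relComp {A B C : Type} [AddCommGroup A] [Module F A] [AddCommGroup B] [Module F B]
    [AddCommGroup C] [Module F C] (R : Submodule F (A × B)) (S : Submodule F (B × C)) :
    Submodule F (A × C) where
  carrier := {p | ∃ b, (p.1, b) ∈ R ∧ (b, p.2) ∈ S}
  zero_mem' := ⟨0, R.zero_mem, S.zero_mem⟩
  add_mem' := by
    rintro p q ⟨b, h1, h2⟩ ⟨c, h3, h4⟩
    exact ⟨b + c, R.add_mem h1 h3, S.add_mem h2 h4⟩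
  smul_mem' := by
    rintro a p ⟨b, h1, h2⟩
    exact ⟨a • b, R.smul_mem a h1, S.smul_mem a h2⟩

open Classical in
/-- The identity relation if `i = r`, and `R` otherwise. -/
noncomputable def reachAt (r i : DV) (R : Submodule F (M r × M i)) : Submodule F (M r × M i) :=
  if h : r = i then h ▸ LinearMap.graph LinearMap.id else R

theorem reachAt_self (r : DV) (R : Submodule F (M r × M r)) :
    reachAt r r R = LinearMap.graph LinearMap.id := by
  simp [reachAt]

theorem reachAt_of_ne {r i : DV} (h : r ≠ i) (R : Submodule F (M r × M i)) :
    reachAt r i R = R := by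
  simp [reachAt, h]

open Classical in
/-- One step of `reach` along an edge. -/
noncomputable def reachStep (ε : ∀ e : DE, Submodule F (M e.par × M e.child)) (r : DV) (e : DE)
    (R : Submodule F (M r × M e.par)) : Submodule F (M r × M e.child) :=
  reachAt r e.child (if r.Below e.par then relComp R (ε e) else ⊥)

/-- `reach` along the long arm. -/
noncomputable def reachLong (ε : ∀ e : DE, Submodule F (M e.par × M e.child)) (r : DV) :
    ∀ n : ℕ, Submodule F (M r × M (.long n))
  | 0 => reachAt r (.long 0) ⊥
  | n + 1 => reachStep ε r (.el n) (reachLong ε r n)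

/-- The composite of the edge relations `ε` along the path from `r` to `i`, if that path leads
away from the trivalent vertex, and zero otherwise. -/
noncomputable def reach (ε : ∀ e : DE, Submodule F (M e.par × M e.child)) (r : DV) :
    ∀ i : DV, Submodule F (M r × M i)
  | .long n => reachLong ε r n
  | .x => reachStep ε r .ex (reachLong ε r 0)
  | .y => reachStep ε r .ey (reachLong ε r 0)

variable {ε : ∀ e : DE, Submodule F (M e.par × M e.child)}
  {η : ∀ e : DE, Submodule F (N e.par × N e.child)}

theorem reach_child_eq (r : DV) (e : DE) :
    reach ε r e.child = reachStep ε r e (reach ε r e.par) := by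
  cases e <;> rfl

theorem mem_reach_self {r : DV} {v u : M r} : (v, u) ∈ reach ε r r ↔ u = v := by
  have : reach ε r r = LinearMap.graph LinearMap.id := by
    cases r with
    | x => exact reachAt_self _ _
    | y => exact reachAt_self _ _
    | long n => cases n <;> exact reachAt_self _ _
  rw [this, LinearMap.mem_graph_iff]
  rfl

theorem mem_reach_child {r : DV} {e : DE} (h : r.Below e.par) {v : M r} {u : M e.child} :
    (v, u) ∈ reach ε r e.child ↔ ∃ w, (v, w) ∈ reach ε r e.par ∧ (w, u) ∈ ε e := by
  rw [reach_child_eq, reachStep, reachAt_of_ne (DV.ne_child h), if_pos h]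
  rfl

theorem mem_reach_of_not_below {r i : DV} (h : ¬ r.Below i) {v : M r} {u : M i} :
    (v, u) ∈ reach ε r i ↔ v = 0 ∧ u = 0 := by
  have hne : r ≠ i := by rintro rfl; exact h (DV.below_refl _)
  have hs : ∀ e : DE, ¬ r.Below e.child → reach ε r e.child = ⊥ := by
    intro e he
    rw [DV.below_child_iff, not_or] at he
    rw [reach_child_eq, reachStep, reachAt_of_ne he.1, if_neg he.2]
  have : reach ε r i = ⊥ := by
    cases i with
    | x => exact hs .ex h
    | y => exact hs .ey h
    | long n =>
      cases n with
      | zero => exact reachAt_of_ne hne _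
      | succ n => exact hs (.el n) h
  rw [this, Submodule.mem_bot, Prod.mk_eq_zero]

/-- Vectors of the root that propagate to `i`. -/
noncomputable def reachDom (ε : ∀ e : DE, Submodule F (M e.par × M e.child)) (r i : DV) :
    Submodule F (M r) :=
  (reach ε r i).map (LinearMap.fst F _ _)

/-- Vectors of the root that propagate to zero at `i`. -/
noncomputable def reachKer (ε : ∀ e : DE, Submodule F (M e.par × M e.child)) (r i : DV) :
    Submodule F (M r) :=
  (reach ε r i).comap (LinearMap.inl F _ _)

theorem mem_reachDom {r i : DV} {v : M r} :
    v ∈ reachDom ε r i ↔ ∃ u, (v, u) ∈ reach ε r i := by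
  simp [reachDom]

theorem mem_reachKer {r i : DV} {v : M r} : v ∈ reachKer ε r i ↔ (v, 0) ∈ reach ε r i := by
  simp [reachKer]

/-- The vectors at `i` reached from the subspace `P` at the root. -/
noncomputable def reachImage (ε : ∀ e : DE, Submodule F (M e.par × M e.child)) (r : DV)
    (P : Submodule F (M r)) (i : DV) : Submodule F (M i) :=
  ((reach ε r i) ⊓ P.comap (LinearMap.fst F _ _)).map (LinearMap.snd F _ _)

theorem mem_reachImage {r i : DV} {P : Submodule F (M r)} {u : M i} :
    u ∈ reachImage ε r P i ↔ ∃ v ∈ P, (v, u) ∈ reach ε r i := by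
  simp [reachImage, and_comm]

theorem reachImage_self {r : DV} (P : Submodule F (M r)) : reachImage ε r P r = P := by
  ext u
  rw [mem_reachImage]
  exact ⟨fun ⟨v, hv, hu⟩ => mem_reach_self.1 hu ▸ hv, fun hu => ⟨u, hu, mem_reach_self.2 rfl⟩⟩

theorem eq_zero_of_mem_reachImage {r i : DV} (h : ¬ r.Below i) {P : Submodule F (M r)} {u : M i}
    (hu : u ∈ reachImage ε r P i) : u = 0 := by
  obtain ⟨v, -, hv⟩ := mem_reachImage.1 hu
  exact ((mem_reach_of_not_below h).1 hv).2

/-- The edge relations are the graphs of linear maps, pointing away from the trivalent vertex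
exactly on the edges in `out`. -/
structure IsArrowRel (out : Set DE) (ε : ∀ e : DE, Submodule F (M e.par × M e.child)) : Prop where
  total : ∀ e ∈ out, ∀ p, ∃ c, (p, c) ∈ ε e
  single : ∀ e ∈ out, ∀ c, (0, c) ∈ ε e → c = 0
  onto : ∀ e ∉ out, ∀ c, ∃ p, (p, c) ∈ ε e
  inj : ∀ e ∉ out, ∀ p, (p, 0) ∈ ε e → p = 0

/-- The vectors at the far end of the edge are a quotient of a subspace at the near end. -/
def GoodEdge (ε : ∀ e : DE, Submodule F (M e.par × M e.child)) (e : DE) : Prop :=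
  (∀ c, ∃ p, (p, c) ∈ ε e) ∧ ∀ c, (0, c) ∈ ε e → c = 0

/-- Stability of a family of subspaces under the arrows. -/
def ArrowStable (out : Set DE) (ε : ∀ e : DE, Submodule F (M e.par × M e.child))
    (S : ∀ i, Submodule F (M i)) : Prop :=
  ∀ e p c, (p, c) ∈ ε e → (e ∈ out → p ∈ S e.par → c ∈ S e.child) ∧
    (e ∉ out → c ∈ S e.child → p ∈ S e.par)

/-- Absence of proper direct sum decompositions. -/
def ArrowIndec (out : Set DE) (ε : ∀ e : DE, Submodule F (M e.par × M e.child)) : Prop :=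
  ∀ S T : ∀ i, Submodule F (M i), (∀ i, IsCompl (S i) (T i)) → ArrowStable out ε S →
    ArrowStable out ε T → (∀ i, S i = ⊥) ∨ (∀ i, T i = ⊥)

section Good

variable {r : DV} (hg : ∀ e : DE, r.Below e.par → GoodEdge ε e)

include hg

theorem reach_onto {i : DV} (h : r.Below i) : ∀ u : M i, ∃ v, (v, u) ∈ reach ε r i := by
  refine DV.Below.induction (p := fun i => ∀ u : M i, ∃ v, (v, u) ∈ reach ε r i)
    (fun u => ⟨u, mem_reach_self.2 rfl⟩) (fun e he ih u => ?_) i h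
  obtain ⟨w, hw⟩ := (hg e he).1 u
  obtain ⟨v, hv⟩ := ih w
  exact ⟨v, (mem_reach_child he).2 ⟨w, hv, hw⟩⟩

theorem eq_zero_of_reach {i : DV} (h : r.Below i) : ∀ u : M i, (0, u) ∈ reach ε r i → u = 0 := by
  refine DV.Below.induction (p := fun i => ∀ u : M i, (0, u) ∈ reach ε r i → u = 0)
    (fun u hu => mem_reach_self.1 hu) (fun e he ih u hu => ?_) i h
  obtain ⟨w, hw, hwu⟩ := (mem_reach_child he).1 hu
  rw [ih w hw] at hwu
  exact (hg e he).2 u hwu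

theorem isCompl_reachImage {i : DV} (h : r.Below i) {P H : Submodule F (M r)} (hc : IsCompl P H)
    (hd : Splits (reachDom ε r i) P H) (hk : Splits (reachKer ε r i) P H) :
    IsCompl (reachImage ε r P i) (reachImage ε r H i) := by
  constructor
  · rw [Submodule.disjoint_def]
    intro u hu hu'
    obtain ⟨p, hp, hpu⟩ := mem_reachImage.1 hu
    obtain ⟨q, hq, hqu⟩ := mem_reachImage.1 hu'
    have h1 : p - q ∈ reachKer ε r i := by
      rw [mem_reachKer]
      simpa using (reach ε r i).sub_mem hpu hqu
    obtain ⟨a, ⟨ha, haP⟩, b, ⟨hb, hbH⟩, hab⟩ := Submodule.mem_sup.1 (hk h1)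
    have h2 : p = a := by
      have h3 : p - a ∈ P := P.sub_mem hp haP
      have h4 : p - a ∈ H := by
        have : p - a = q + b := by
          rw [sub_eq_iff_eq_add, add_assoc, add_comm b a, hab]; abel
        rw [this]
        exact H.add_mem hq hbH
      exact sub_eq_zero.1 (Submodule.disjoint_def.1 hc.disjoint _ h3 h4)
    subst h2
    refine eq_zero_of_reach hg h u ?_
    simpa using (reach ε r i).sub_mem hpu (mem_reachKer.1 ha)
  · rw [codisjoint_iff, eq_top_iff]
    intro u _
    obtain ⟨v, hv⟩ := reach_onto hg h u
    obtain ⟨a, ⟨ha, haP⟩, b, ⟨hb, hbH⟩, rfl⟩ :=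
      Submodule.mem_sup.1 (hd (mem_reachDom.2 ⟨u, hv⟩))
    obtain ⟨w, hw⟩ := mem_reachDom.1 ha
    have h3 := (reach ε r i).sub_mem hv hw
    simp only [Prod.mk_sub_mk, add_sub_cancel_left] at h3
    rw [show u = w + (u - w) by abel]
    exact Submodule.add_mem_sup (mem_reachImage.2 ⟨a, haP, hw⟩) (mem_reachImage.2 ⟨b, hbH, h3⟩)

open Classical in
/-- A decomposition at the root compatible with the kernels and domains of propagation extends
to the whole representation. -/
theorem ArrowIndec.eq_bot_or {out : Set DE} (ha : IsArrowRel out ε) (hI : ArrowIndec out ε)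
    {P H : Submodule F (M r)} (hc : IsCompl P H)
    (hd : ∀ i, r.Below i → Splits (reachDom ε r i) P H)
    (hk : ∀ i, r.Below i → Splits (reachKer ε r i) P H)
    (hin : ∀ e p c, (p, c) ∈ ε e → r = e.child → (e ∈ out → c ∈ reachImage ε r H e.child) ∧
      (e ∉ out → c ∈ reachImage ε r P e.child → p = 0)) :
    P = ⊥ ∨ (H = ⊥ ∧ ∀ i, ¬ r.Below i → ∀ u : M i, u = 0) := by
  have hstab : ∀ (Q : Submodule F (M r)) (e : DE) (p : M e.par) (c : M e.child), (p, c) ∈ ε e →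
      r.Below e.par → (e ∈ out → p ∈ reachImage ε r Q e.par → c ∈ reachImage ε r Q e.child) ∧
      (e ∉ out → c ∈ reachImage ε r Q e.child → p ∈ reachImage ε r Q e.par) := by
    intro Q e p c hpc he
    refine ⟨fun _ hp => ?_, fun hout hc => ?_⟩
    · obtain ⟨v, hv, hvp⟩ := mem_reachImage.1 hp
      exact mem_reachImage.2 ⟨v, hv, (mem_reach_child he).2 ⟨p, hvp, hpc⟩⟩
    · obtain ⟨v, hv, hvc⟩ := mem_reachImage.1 hc
      obtain ⟨w, hvw, hwc⟩ := (mem_reach_child he).1 hvc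
      have : w - p = 0 := ha.inj e hout _ (by simpa using (ε e).sub_mem hwc hpc)
      rw [← sub_eq_zero.1 this]
      exact mem_reachImage.2 ⟨v, hv, hvw⟩
  have key := hI (reachImage ε r P) (fun i => if r.Below i then reachImage ε r H i else ⊤)
    ?_ ?_ ?_
  · rcases key with h | h
    · exact Or.inl (reachImage_self (ε := ε) P ▸ h r)
    · refine Or.inr ⟨?_, fun i hi u => ?_⟩
      · have := h r
        rwa [if_pos (DV.below_refl r), reachImage_self] at this
      · have := h i
        rw [if_neg hi] at this
        rw [← Submodule.mem_bot (R := F), ← this]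
        trivial
  · intro i
    by_cases hi : r.Below i
    · rw [if_pos hi]
      exact isCompl_reachImage hg hi hc (hd i hi) (hk i hi)
    · rw [if_neg hi]
      have : reachImage ε r P i = ⊥ := eq_bot_iff.2 fun u hu => eq_zero_of_mem_reachImage hi hu
      rw [this]
      exact isCompl_bot_top
  · intro e p c hpc
    by_cases he : r.Below e.par
    · exact hstab P e p c hpc he
    · refine ⟨fun hout hp => ?_, fun hout hc => ?_⟩
      · rw [eq_zero_of_mem_reachImage he hp] at hpc
        rw [ha.single e hout c hpc]
        exact Submodule.zero_mem _
      · have hp : p = 0 := by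
          by_cases hr : r = e.child
          · exact (hin e p c hpc hr).2 hout hc
          · have : ¬ r.Below e.child := by rw [DV.below_child_iff]; tauto
            rw [eq_zero_of_mem_reachImage this hc] at hpc
            exact ha.inj e hout p hpc
        rw [hp]
        exact Submodule.zero_mem _
  · intro e p c hpc
    beta_reduce
    by_cases he : r.Below e.par
    · rw [if_pos he, if_pos he.child]
      exact hstab H e p c hpc he
    · rw [if_neg he]
      refine ⟨fun hout _ => ?_, fun _ _ => trivial⟩
      split_ifs with hch
      · have hr : r = e.child := (DV.below_child_iff.1 hch).resolve_right he
        exact (hin e p c hpc hr).1 hout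
      · trivial

end Good

theorem reachDom_self (r : DV) : reachDom ε r r = ⊤ :=
  eq_top_iff.2 fun v _ => mem_reachDom.2 ⟨v, mem_reach_self.2 rfl⟩

theorem reachKer_self (r : DV) : reachKer ε r r = ⊥ :=
  eq_bot_iff.2 fun _ hv => (mem_reach_self.1 (mem_reachKer.1 hv)).symm

theorem reachDom_of_not_below {r i : DV} (h : ¬ r.Below i) : reachDom ε r i = ⊥ := by
  refine eq_bot_iff.2 fun v hv => ?_
  obtain ⟨u, hu⟩ := mem_reachDom.1 hv
  exact ((mem_reach_of_not_below h).1 hu).1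

theorem reachKer_of_not_below {r i : DV} (h : ¬ r.Below i) : reachKer ε r i = ⊥ :=
  eq_bot_iff.2 fun _ hv => ((mem_reach_of_not_below h).1 (mem_reachKer.1 hv)).1

theorem reachDom_child_le {r : DV} {e : DE} (h : r.Below e.par) :
    reachDom ε r e.child ≤ reachDom ε r e.par := by
  intro v hv
  obtain ⟨u, hu⟩ := mem_reachDom.1 hv
  obtain ⟨w, hw, -⟩ := (mem_reach_child h).1 hu
  exact mem_reachDom.2 ⟨w, hw⟩

theorem reachKer_le_child {r : DV} {e : DE} (h : r.Below e.par) :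
    reachKer ε r e.par ≤ reachKer ε r e.child := fun _ hv =>
  mem_reachKer.2 ((mem_reach_child h).2 ⟨0, mem_reachKer.1 hv, (ε e).zero_mem⟩)

theorem reachKer_le_reachDom (r i : DV) : reachKer ε r i ≤ reachDom ε r i := fun _ hv =>
  mem_reachDom.2 ⟨0, mem_reachKer.1 hv⟩

theorem IsArrowRel.reachDom_child {out : Set DE} (ha : IsArrowRel out ε) {r : DV} {e : DE}
    (he : e ∈ out) (h : r.Below e.par) : reachDom ε r e.child = reachDom ε r e.par := by
  refine le_antisymm (reachDom_child_le h) fun v hv => ?_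
  obtain ⟨w, hw⟩ := mem_reachDom.1 hv
  obtain ⟨c, hc⟩ := ha.total e he w
  exact mem_reachDom.2 ⟨c, (mem_reach_child h).2 ⟨w, hw, hc⟩⟩

theorem IsArrowRel.reachKer_child_eq_bot {out : Set DE} (ha : IsArrowRel out ε) {e : DE}
    (he : e ∉ out) : reachKer ε e.par e.child = ⊥ := by
  refine eq_bot_iff.2 fun v hv => ?_
  obtain ⟨w, hw, hwc⟩ := (mem_reach_child (DV.below_refl _)).1 (mem_reachKer.1 hv)
  rw [mem_reach_self.1 hw] at hwc
  exact ha.inj e he v hwc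

open Classical in
/-- The subspace of the root determined by a short leg. -/
noncomputable def legSub (out : Set DE) (ε : ∀ e : DE, Submodule F (M e.par × M e.child)) (r : DV)
    (e : DE) : Submodule F (M r) :=
  if e ∈ out then reachKer ε r e.child else reachDom ε r e.child

open Classical in
/-- The vectors of the root that propagate to `long n`, everything if `long n` is not below the
root. -/
noncomputable def armDom (ε : ∀ e : DE, Submodule F (M e.par × M e.child)) (r : DV) (n : ℕ) :
    Submodule F (M r) :=
  if r.Below (.long n) then reachDom ε r (.long n) else ⊤

/-- The chain of kernels and domains of propagation along the long arm. -/
noncomputable def armChain (ε : ∀ e : DE, Submodule F (M e.par × M e.child)) (r : DV) (N : ℕ)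
    (d : Bool ×ₗ ℕ) : Submodule F (M r) :=
  if (ofLex d).1 then armDom ε r (N - (ofLex d).2) else reachKer ε r (.long (ofLex d).2)

theorem monotone_reachKer_long (r : DV) : Monotone fun n => reachKer ε r (.long n) := by
  refine monotone_nat_of_le_succ fun n => ?_
  by_cases h : r.Below (.long n)
  · exact reachKer_le_child (e := .el n) h
  · rw [reachKer_of_not_below h]
    exact bot_le

theorem antitone_armDom (r : DV) : Antitone (armDom ε r) := by
  refine antitone_nat_of_succ_le fun n => ?_
  unfold armDom
  by_cases h : r.Below (.long n)
  · rw [if_pos h, if_pos (show r.Below (.long (n + 1)) from DV.Below.child (e := .el n) h)]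
    exact reachDom_child_le (e := .el n) h
  · rw [if_neg h]
    exact le_top

theorem reachKer_le_armDom (r : DV) (m n : ℕ) : reachKer ε r (.long m) ≤ armDom ε r n := by
  have h : ∀ k, reachKer ε r (.long k) ≤ armDom ε r k := by
    intro k
    unfold armDom
    split_ifs
    · exact reachKer_le_reachDom _ _
    · exact le_top
  rcases le_total m n with hmn | hmn
  · exact (monotone_reachKer_long r hmn).trans (h n)
  · exact (h m).trans (antitone_armDom r hmn)

theorem monotone_armChain (r : DV) (N : ℕ) : Monotone (armChain ε r N) := by
  intro a b hab
  rw [Prod.Lex.le_iff] at hab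
  unfold armChain
  rcases hab with hab | ⟨h1, h2⟩
  · have := Bool.lt_iff.1 hab
    rw [if_neg (by simp [this.1]), if_pos this.2]
    exact reachKer_le_armDom _ _ _
  · rw [h1]
    split_ifs
    · exact antitone_armDom r (Nat.sub_le_sub_left h2 N)
    · exact monotone_reachKer_long r h2

theorem armDom_zero (r : DV) : armDom ε r 0 = ⊤ := by
  unfold armDom
  split_ifs with h
  · cases r <;> simp [DV.Below] at h
    subst h
    exact reachDom_self _
  · rfl

theorem armChain_top (r : DV) (N : ℕ) : ∃ d, armChain ε r N d = ⊤ := by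
  refine ⟨toLex (true, N), ?_⟩
  simp only [armChain, ofLex_toLex, if_true, Nat.sub_self]
  exact armDom_zero r

theorem armChain_ker (r : DV) (N n : ℕ) :
    armChain ε r N (toLex (false, n)) = reachKer ε r (.long n) := by
  simp [armChain]

theorem IsArrowRel.armDom_eq {out : Set DE} (ha : IsArrowRel out ε) {N : ℕ}
    (hN : ∀ n ≥ N, .el n ∈ out) (r : DV) {n : ℕ} (hn : N ≤ n) : armDom ε r n = armDom ε r N := by
  induction n, hn using Nat.le_induction with
  | base => rfl
  | succ n hn ih =>
    rw [← ih]
    unfold armDom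
    by_cases h : r.Below (.long n)
    · rw [if_pos h, if_pos (show r.Below (.long (n + 1)) from DV.Below.child (e := .el n) h)]
      exact ha.reachDom_child (hN n hn) h
    · rw [if_neg h]
      split_ifs with h'
      · obtain rfl : r = .long (n + 1) :=
          ((DV.below_child_iff (e := .el n)).1 h').resolve_right h
        exact reachDom_self _
      · rfl

theorem IsArrowRel.exists_armChain_eq {out : Set DE} (ha : IsArrowRel out ε) {N : ℕ}
    (hN : ∀ n ≥ N, .el n ∈ out) {r : DV} {n : ℕ} (h : r.Below (.long n)) :
    reachDom ε r (.long n) = armChain ε r N (toLex (true, N - n)) := by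
  have h1 : armDom ε r n = reachDom ε r (.long n) := if_pos h
  simp only [armChain, ofLex_toLex, if_true]
  rw [← h1]
  rcases le_total n N with hn | hn
  · rw [Nat.sub_sub_self hn]
  · rw [ha.armDom_eq hN r hn, Nat.sub_eq_zero_of_le hn, Nat.sub_zero]

theorem below_leg {r : DV} {e : DE} (he : e.par = .long 0) (h : r.Below e.child) :
    r = e.child ∨ r = e.par := by
  rcases DV.below_child_iff.1 h with h | h
  · exact Or.inl h
  · rw [he] at h ⊢
    cases r <;> simp [DV.Below] at h
    exact Or.inr (h ▸ rfl)

end Tree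

section Roots

variable {F : Type} [Field F] {M : DV → Type} [∀ i, AddCommGroup (M i)] [∀ i, Module F (M i)]
  {N : DV → Type} [∀ i, AddCommGroup (N i)] [∀ i, Module F (N i)]
  {ε : ∀ e : DE, Submodule F (M e.par × M e.child)}
  {η : ∀ e : DE, Submodule F (N e.par × N e.child)} {out : Set DE} {K : ℕ}

theorem IsArrowRel.reachDom_leg (ha : IsArrowRel out ε) {e : DE} (he : e ∈ out) :
    reachDom ε e.par e.child = ⊤ := by
  rw [ha.reachDom_child he (DV.below_refl _), reachDom_self]

/-- A property of pairs of subspaces that holds for the distinguished ones holds for all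
domains and kernels of propagation. -/
theorem IsArrowRel.reach_rel (ha : IsArrowRel out ε) (ha' : IsArrowRel out η)
    (hK : ∀ n ≥ K, .el n ∈ out) {r : DV} (p : Submodule F (M r) → Submodule F (N r) → Prop)
    (htop : p ⊤ ⊤) (hbot : p ⊥ ⊥) (hx : p (legSub out ε r .ex) (legSub out η r .ex))
    (hy : p (legSub out ε r .ey) (legSub out η r .ey))
    (hG : ∀ d, p (armChain ε r K d) (armChain η r K d)) {i : DV} (h : r.Below i) :
    p (reachDom ε r i) (reachDom η r i) ∧ p (reachKer ε r i) (reachKer η r i) := by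
  have hleg : ∀ e : DE, e.par = .long 0 → p (legSub out ε r e) (legSub out η r e) →
      r.Below e.child → p (reachDom ε r e.child) (reachDom η r e.child) ∧
        p (reachKer ε r e.child) (reachKer η r e.child) := by
    intro e he hp hr
    rcases below_leg he hr with rfl | rfl
    · rw [reachDom_self, reachDom_self, reachKer_self, reachKer_self]
      exact ⟨htop, hbot⟩
    · unfold legSub at hp
      by_cases ho : e ∈ out
      · rw [if_pos ho, if_pos ho] at hp
        rw [ha.reachDom_leg ho, ha'.reachDom_leg ho]
        exact ⟨htop, hp⟩
      · rw [if_neg ho, if_neg ho] at hp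
        rw [ha.reachKer_child_eq_bot ho, ha'.reachKer_child_eq_bot ho]
        exact ⟨hp, hbot⟩
  cases i with
  | x => exact hleg .ex rfl hx h
  | y => exact hleg .ey rfl hy h
  | long n =>
    rw [ha.exists_armChain_eq hK h, ha'.exists_armChain_eq hK h, ← armChain_ker (ε := ε) r K,
      ← armChain_ker (ε := η) r K]
    exact ⟨hG _, hG _⟩

theorem legSub_of_ne {r : DV} {e : DE} (he : e.par = .long 0) (h : r ≠ e.par) :
    legSub out ε r e = ⊥ ∨ legSub out ε r e = ⊤ := by
  unfold legSub
  by_cases hr : r.Below e.child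
  · obtain rfl := (below_leg he hr).resolve_right h
    rw [reachDom_self, reachKer_self]
    split_ifs <;> simp
  · rw [reachDom_of_not_below hr, reachKer_of_not_below hr]
    simp

theorem DE.child_injective : Function.Injective DE.child := by
  intro e e' h
  cases e <;> cases e' <;> simp_all [DE.child]

/-- The support of the representation is the set of vertices beyond `r`, and it is generated by
its value at `r` through subquotients. -/
structure IsRoot (ε : ∀ e : DE, Submodule F (M e.par × M e.child)) (r : DV) : Prop where
  nontriv : ∃ v : M r, v ≠ 0
  good : ∀ e : DE, r.Below e.par → GoodEdge ε e
  zero : ∀ i, ¬ r.Below i → ∀ u : M i, u = 0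

theorem IsArrowRel.splits_reach (ha : IsArrowRel out ε) (hK : ∀ n ≥ K, .el n ∈ out) {r : DV}
    {P H : Submodule F (M r)} (hc : IsCompl P H) (hx : Splits (legSub out ε r .ex) P H)
    (hy : Splits (legSub out ε r .ey) P H) (hG : ∀ d, Splits (armChain ε r K d) P H) {i : DV}
    (h : r.Below i) : Splits (reachDom ε r i) P H ∧ Splits (reachKer ε r i) P H :=
  ha.reach_rel ha hK (fun S _ => Splits S P H) (splits_top hc) splits_bot hx hy hG h

theorem isRoot_of_not_goodEdge (ha : IsArrowRel out ε) (hI : ArrowIndec out ε)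
    (hK : ∀ n ≥ K, .el n ∈ out) {e : DE} (hb : ¬ GoodEdge ε e)
    (hg : ∀ e' : DE, e.child.Below e'.par → GoodEdge ε e') : IsRoot ε e.child := by
  have hleg : ∀ (e' : DE), e'.par = .long 0 → ∀ P H, IsCompl P H →
      Splits (legSub out ε e.child e') P H := by
    intro e' he' P H hc
    have hne : e.child ≠ e'.par := by rw [he']; cases e <;> simp [DE.child]
    rcases legSub_of_ne (out := out) (ε := ε) he' hne with h | h <;> rw [h]
    · exact splits_bot
    · exact splits_top hc
  have main : ∀ P H : Submodule F (M e.child), IsCompl P H → P ≠ ⊥ →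
      (∀ d, Splits (armChain ε e.child K d) P H) →
      (∀ p c, (p, c) ∈ ε e → (e ∈ out → c ∈ H) ∧ (e ∉ out → c ∈ P → p = 0)) →
      IsRoot ε e.child := by
    intro P H hc hP hG hin
    have hs := fun i (hi : e.child.Below i) => ha.splits_reach hK hc (hleg .ex rfl P H hc)
      (hleg .ey rfl P H hc) hG hi
    have := ArrowIndec.eq_bot_or hg ha hI hc (fun i hi => (hs i hi).1) (fun i hi => (hs i hi).2) ?_
    · obtain ⟨v, -, hv⟩ := Submodule.exists_mem_ne_zero_of_ne_bot hP
      exact ⟨⟨v, hv⟩, hg, (this.resolve_left hP).2⟩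
    · intro e' p c hpc hr
      obtain rfl := DE.child_injective hr
      rw [reachImage_self, reachImage_self]
      exact hin p c hpc
  by_cases ho : e ∈ out
  · have hI' : (ε e).map (LinearMap.snd F _ _) ≠ ⊤ := by
      intro htop
      refine hb ⟨fun c => ?_, ha.single e ho⟩
      have : c ∈ (ε e).map (LinearMap.snd F _ _) := by rw [htop]; trivial
      simpa using this
    obtain ⟨v, H, hv, hIH, hc, hG⟩ := exists_isCompl_splits_of_ne_top
      (monotone_armChain (ε := ε) e.child K) (armChain_top e.child K) hI'
    refine main _ H hc (mt Submodule.span_singleton_eq_bot.1 hv) hG fun p c hpc =>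
      ⟨fun _ => hIH ⟨_, hpc, rfl⟩, fun h => absurd ho h⟩
  · obtain ⟨c, hc0, hc⟩ : ∃ c, (0, c) ∈ ε e ∧ c ≠ 0 := by
      by_contra! hcon
      exact hb ⟨ha.onto e ho, hcon⟩
    obtain ⟨H, hcompl, hG⟩ := exists_isCompl_span_splits (monotone_armChain (ε := ε) e.child K) hc
    refine main _ H hcompl (mt Submodule.span_singleton_eq_bot.1 hc) hG fun p c' hpc =>
      ⟨fun h => absurd h ho, fun _ hc' => ?_⟩
    obtain ⟨a, rfl⟩ := Submodule.mem_span_singleton.1 hc'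
    refine ha.inj e ho p ?_
    simpa using (ε e).sub_mem hpc ((ε e).smul_mem a hc0)

theorem exists_isRoot (ha : IsArrowRel out ε) (hI : ArrowIndec out ε)
    (hK : ∀ n ≥ K, .el n ∈ out) (hfin : {e | ¬ GoodEdge ε e}.Finite)
    (hne : ∃ i, ∃ u : M i, u ≠ 0) : ∃ r, IsRoot ε r := by
  by_cases hx : GoodEdge ε .ex
  swap
  · exact ⟨_, isRoot_of_not_goodEdge ha hI hK hx fun e' h => by
      cases e' <;> simp [DV.Below, DE.child, DE.par] at h⟩
  by_cases hy : GoodEdge ε .ey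
  swap
  · exact ⟨_, isRoot_of_not_goodEdge ha hI hK hy fun e' h => by
      cases e' <;> simp [DV.Below, DE.child, DE.par] at h⟩
  by_cases hl : ∀ n, GoodEdge ε (.el n)
  · have hg : ∀ e : DE, GoodEdge ε e := by
      rintro (_ | _ | n)
      exacts [hx, hy, hl n]
    refine ⟨.long 0, ?_, fun e _ => hg e, fun i hi => absurd (DV.long_zero_below i) hi⟩
    obtain ⟨i, u, hu⟩ := hne
    obtain ⟨v, hv⟩ := reach_onto (r := .long 0) (fun e _ => hg e) (DV.long_zero_below i) u
    refine ⟨v, fun hv0 => hu ?_⟩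
    rw [hv0] at hv
    exact eq_zero_of_reach (fun e _ => hg e) (DV.long_zero_below i) u hv
  · push Not at hl
    have hfin' : {n | ¬ GoodEdge ε (.el n)}.Finite :=
      hfin.preimage (f := DE.el) (fun a _ b _ h => DE.el.inj h)
    obtain ⟨n, hn, hmax⟩ := Set.exists_max_image _ id hfin' hl
    refine ⟨_, isRoot_of_not_goodEdge ha hI hK hn fun e' h => ?_⟩
    cases e' with
    | ex => exact hx
    | ey => exact hy
    | el m =>
      by_contra hm
      have h1 : m ≤ n := hmax m hm
      have h2 : n + 1 ≤ m := h
      omega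

theorem IsRoot.filtIndec {r : DV} (hr : IsRoot ε r) (ha : IsArrowRel out ε)
    (hI : ArrowIndec out ε) (hK : ∀ n ≥ K, .el n ∈ out) :
    FiltIndec (legSub out ε r .ex) (legSub out ε r .ey) (armChain ε r K) where
  mono := monotone_armChain r K
  top := armChain_top r K
  nontriv := hr.nontriv
  split P H hc hX hY hG := by
    have hs := fun i (hi : r.Below i) => ha.splits_reach hK hc hX hY hG hi
    refine (ArrowIndec.eq_bot_or hr.good ha hI hc (fun i hi => (hs i hi).1)
      (fun i hi => (hs i hi).2) ?_).imp_right And.left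
    intro e p c hpc he
    have hp : p = 0 := hr.zero _ (fun h => DV.ne_child h he) p
    refine ⟨fun ho => ?_, fun _ _ => hp⟩
    rw [ha.single e ho c (hp ▸ hpc)]
    exact Submodule.zero_mem _

end Roots

/-! ### Morphisms -/

section Morphisms

variable {F : Type} [Field F] {M : DV → Type} [∀ i, AddCommGroup (M i)] [∀ i, Module F (M i)]
  {N : DV → Type} [∀ i, AddCommGroup (N i)] [∀ i, Module F (N i)]
  {ε : ∀ e : DE, Submodule F (M e.par × M e.child)}
  {η : ∀ e : DE, Submodule F (N e.par × N e.child)} {out : Set DE} {K : ℕ}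

open Classical in
/-- A rank on vertices, compatible with the existence of nonzero morphisms. -/
noncomputable def rootRank (out : Set DE) (K : ℕ) : DV → ℕ
  | .long 0 => K + 1
  | .long (n + 1) => if .el n ∈ out then K + 2 + n else K - n
  | .x => if .ex ∈ out then K + 2 else 0
  | .y => if .ey ∈ out then K + 2 else 0

theorem rootRank_child (hK : ∀ n ≥ K, .el n ∈ out) {r : DV} {e : DE} (h : r.Below e.par) :
    (e ∈ out → rootRank out K r < rootRank out K e.child) ∧
      (e ∉ out → rootRank out K e.child < rootRank out K r) := by
  have key : ∀ m n, m ≤ n → (.el n ∈ out → rootRank out K (.long m) < K + 2 + n) ∧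
      (.el n ∉ out → K - n < rootRank out K (.long m)) := by
    intro m n hmn
    have hn : .el n ∉ out → n < K := fun h => not_le.1 fun h' => h (hK n h')
    cases m with
    | zero =>
      simp only [rootRank]
      omega
    | succ m =>
      simp only [rootRank]
      split_ifs with h1
      · omega
      · refine ⟨fun _ => by omega, fun h2 => ?_⟩
        have := hn h2
        omega
  cases e with
  | el n =>
    cases r <;> simp [DV.Below, DE.par] at h
    refine ⟨fun ho => ?_, fun ho => ?_⟩
    · simpa [rootRank, DE.child, ho] using (key _ n h).1 ho
    · simpa [rootRank, DE.child, ho] using (key _ n h).2 ho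
  | ex =>
    cases r <;> simp [DV.Below, DE.par] at h
    subst h
    constructor <;> intro ho <;> simp [rootRank, DE.child, ho]
  | ey =>
    cases r <;> simp [DV.Below, DE.par] at h
    subst h
    constructor <;> intro ho <;> simp [rootRank, DE.child, ho]

variable {f : ∀ i, M i →ₗ[F] N i}
  (hf : ∀ e p c, (p, c) ∈ ε e → (f e.par p, f e.child c) ∈ η e)

include hf

theorem reach_map {r i : DV} {v : M r} {u : M i} (h : (v, u) ∈ reach ε r i) :
    (f r v, f i u) ∈ reach η r i := by
  by_cases hi : r.Below i
  · revert u
    refine DV.Below.induction (p := fun i => ∀ {u : M i}, (v, u) ∈ reach ε r i →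
      (f r v, f i u) ∈ reach η r i) (fun {u} hu => ?_) (fun e he ih u hu => ?_) i hi
    · rw [mem_reach_self] at hu ⊢
      rw [hu]
    · obtain ⟨w, hw, hwu⟩ := (mem_reach_child he).1 hu
      exact (mem_reach_child he).2 ⟨_, ih hw, hf e w u hwu⟩
  · obtain ⟨rfl, rfl⟩ := (mem_reach_of_not_below hi).1 h
    rw [map_zero, map_zero]
    exact Submodule.zero_mem _

theorem apply_mem_reachDom {r i : DV} {v : M r} (h : v ∈ reachDom ε r i) :
    f r v ∈ reachDom η r i := by
  obtain ⟨u, hu⟩ := mem_reachDom.1 h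
  exact mem_reachDom.2 ⟨_, reach_map hf hu⟩

theorem apply_mem_reachKer {r i : DV} {v : M r} (h : v ∈ reachKer ε r i) :
    f r v ∈ reachKer η r i := by
  have := reach_map hf (mem_reachKer.1 h)
  rw [map_zero] at this
  exact mem_reachKer.2 this

theorem apply_mem_legSub {r : DV} {e : DE} : ∀ v ∈ legSub out ε r e, f r v ∈ legSub out η r e := by
  intro v hv
  unfold legSub at hv ⊢
  split_ifs at hv ⊢
  · exact apply_mem_reachKer hf hv
  · exact apply_mem_reachDom hf hv

theorem apply_mem_armChain {r : DV} (d : Bool ×ₗ ℕ) :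
    ∀ v ∈ armChain ε r K d, f r v ∈ armChain η r K d := by
  intro v hv
  unfold armChain armDom at hv ⊢
  split_ifs at hv ⊢
  · exact apply_mem_reachDom hf hv
  · trivial
  · exact apply_mem_reachKer hf hv

theorem IsRoot.apply_ne_zero {r s m : DV} (hr : IsRoot ε r) (hs : IsRoot η s) (hrm : r.Below m)
    (hsm : s.Below m) {i : DV} (hmi : m.Below i) (hne : f i ≠ 0) : f m ≠ 0 := by
  intro h0
  refine hne (LinearMap.ext fun u => ?_)
  obtain ⟨v, hv⟩ := reach_onto (fun e he => hr.good e (hrm.trans he)) hmi u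
  have := reach_map hf hv
  rw [h0] at this
  exact eq_zero_of_reach (fun e he => hs.good e (hsm.trans he)) hmi _ this

theorem IsRoot.eq_or_rootRank_lt (ha : IsArrowRel out ε) (ha' : IsArrowRel out η)
    (hK : ∀ n ≥ K, .el n ∈ out) {r s : DV} (hr : IsRoot ε r) (hs : IsRoot η s) {i : DV}
    (hne : f i ≠ 0) : (r = s ∧ f r ≠ 0) ∨ rootRank out K s < rootRank out K r := by
  obtain ⟨u, hu⟩ : ∃ u, f i u ≠ 0 := by
    by_contra! h
    exact hne (LinearMap.ext h)
  have hri : r.Below i := by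
    by_contra h
    exact hu (by rw [hr.zero i h u, map_zero])
  have hsi : s.Below i := by
    by_contra h
    exact hu (hs.zero i h _)
  have hzero : ∀ m, f m ≠ 0 → ∃ v, f m v ≠ 0 := fun m hm => by
    by_contra! h
    exact hm (LinearMap.ext h)
  by_cases hrs : r = s
  · subst hrs
    exact Or.inl ⟨rfl, hr.apply_ne_zero hf hs (DV.below_refl r) (DV.below_refl r) hri hne⟩
  right
  rcases DV.below_total hri hsi with h | h
  · obtain ⟨v, hv⟩ := hzero s (hr.apply_ne_zero hf hs h (DV.below_refl s) hsi hne)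
    obtain ⟨e, rfl, he⟩ := h.exists_edge hrs
    refine (rootRank_child hK he).2 fun ho => hv ?_
    obtain ⟨p, hp⟩ := (hr.good e he).1 v
    have h1 := hf e p v hp
    rw [hs.zero e.par (fun h => DV.ne_child h rfl) (f e.par p)] at h1
    exact ha'.single e ho _ h1
  · obtain ⟨v, hv⟩ := hzero r (hr.apply_ne_zero hf hs (DV.below_refl r) h hri hne)
    obtain ⟨e, rfl, he⟩ := h.exists_edge (Ne.symm hrs)
    refine (rootRank_child hK he).1 ?_
    by_contra ho
    obtain ⟨p, hp⟩ := ha.onto e ho v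
    have h1 := hf e p v hp
    rw [hr.zero e.par (fun h => DV.ne_child h rfl) p, map_zero] at h1
    exact hv ((hs.good e he).2 _ h1)

theorem IsRoot.bijective {r : DV} (hr : IsRoot ε r) (hs : IsRoot η r)
    (hb : Function.Bijective (f r))
    (hD : ∀ i, r.Below i → ∀ v, f r v ∈ reachDom η r i → v ∈ reachDom ε r i)
    (hker : ∀ i, r.Below i → ∀ v, f r v ∈ reachKer η r i → v ∈ reachKer ε r i) (i : DV) :
    Function.Bijective (f i) := by
  by_cases hi : r.Below i
  · constructor
    · rw [injective_iff_map_eq_zero]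
      intro u hu
      obtain ⟨v, hv⟩ := reach_onto hr.good hi u
      have h1 := reach_map hf hv
      rw [hu] at h1
      have h2 := mem_reachKer.1 (hker i hi v (mem_reachKer.2 h1))
      exact eq_zero_of_reach hr.good hi u (by simpa using (reach ε r i).sub_mem hv h2)
    · intro w
      obtain ⟨v', hv'⟩ := reach_onto hs.good hi w
      obtain ⟨v, rfl⟩ := hb.2 v'
      obtain ⟨u, hu⟩ := mem_reachDom.1 (hD i hi v (mem_reachDom.2 ⟨w, hv'⟩))
      refine ⟨u, (sub_eq_zero.1 (eq_zero_of_reach hs.good hi _ ?_)).symm⟩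
      simpa using (reach η r i).sub_mem hv' (reach_map hf hu)
  · exact ⟨fun a b _ => (hr.zero i hi a).trans (hr.zero i hi b).symm,
      fun w => ⟨0, (hs.zero i hi _).trans (hs.zero i hi w).symm⟩⟩

omit hf

/-- A well-ordered invariant that decreases along nonzero non-isomorphisms. -/
noncomputable def rootMeasure (out : Set DE) (K : ℕ)
    (ε : ∀ e : DE, Submodule F (M e.par × M e.child)) (r : DV) :
    ℕ ×ₗ ℕ ×ₗ (Bool ×ₗ ℕ) ×ₗ (Bool ×ₗ ℕ) :=
  toLex (rootRank out K r, toLex (pairType (legSub out ε r .ex) (legSub out ε r .ey),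
    toLex (firstNe (armChain ε r K), firstTop (armChain ε r K))))

include hf

theorem rootMeasure_lt (ha : IsArrowRel out ε) (ha' : IsArrowRel out η) (hI : ArrowIndec out ε)
    (hI' : ArrowIndec out η) (hK : ∀ n ≥ K, .el n ∈ out) {r s : DV} (hr : IsRoot ε r)
    (hs : IsRoot η s) (hne : ∃ i, f i ≠ 0) (hiso : ¬ ∀ i, Function.Bijective (f i)) :
    rootMeasure out K η s < rootMeasure out K ε r := by
  obtain ⟨i, hi⟩ := hne
  rcases hr.eq_or_rootRank_lt hf ha ha' hK hs hi with ⟨rfl, h0⟩ | hlt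
  swap
  · exact Prod.Lex.lt_iff.2 (Or.inl hlt)
  refine Prod.Lex.lt_iff.2 (Or.inr ⟨rfl, ?_⟩)
  have h := hr.filtIndec ha hI hK
  have h' := hs.filtIndec ha' hI' hK
  have hX := apply_mem_legSub (out := out) (r := r) (e := .ex) hf
  have hY := apply_mem_legSub (out := out) (r := r) (e := .ey) hf
  have hG := apply_mem_armChain (K := K) (r := r) hf
  rcases (FiltIndec.pairType_le hX hY h h' h0).lt_or_eq with hp | hp
  · exact Prod.Lex.lt_iff.2 (Or.inl hp)
  refine Prod.Lex.lt_iff.2 (Or.inr ⟨hp, ?_⟩)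
  rcases (FiltIndec.firstNe_le hX hY hG h h' h0 hp).lt_or_eq with hn | hn
  · exact Prod.Lex.lt_iff.2 (Or.inl hn)
  refine Prod.Lex.lt_iff.2 (Or.inr ⟨hn, ?_⟩)
  rcases FiltIndec.bijective_or_firstTop_lt hX hY hG h h' h0 hp hn with hb | ht
  swap
  · exact ht
  refine (FiltIndec.firstTop_le hG h h' hb.2).lt_of_ne fun ht => hiso ?_
  have hp' : pairType (legSub out η r .ey) (legSub out η r .ex) =
      pairType (legSub out ε r .ey) (legSub out ε r .ex) := by
    rw [FiltIndec.pairType_comm, hp, FiltIndec.pairType_comm]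
  have key := fun i (hi : r.Below i) => ha.reach_rel ha' hK
    (fun S S' => ∀ v, f r v ∈ S' → v ∈ S) (fun _ _ => trivial)
    (fun v hv => (map_eq_zero_iff (f r) hb.1).1 hv)
    (fun v hv => FiltIndec.mem_left_of_apply_mem hX hY h h' hb.1 hp hv)
    (fun v hv => FiltIndec.mem_left_of_apply_mem hY hX h.symm h'.symm hb.1 hp' hv)
    (fun d v hv => FiltIndec.mem_chain_of_apply_mem hG h h' hb hn ht hv) hi
  exact hr.bijective hf hs hb (fun i hi => (key i hi).1) (fun i hi => (key i hi).2)

end Morphisms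

/-! ### Representations as systems of linear relations -/

namespace QRep

section General

variable {F : Type} [Field F] {Q : Quiv} {V W : QRep F Q}

/-- The map of an arrow, with its endpoints given up to equality. -/
def lin (V : QRep F Q) (a : Q.A) {i j : Q.V} (hs : Q.s a = i) (ht : Q.t a = j) :
    V.M i →ₗ[F] V.M j :=
  hs ▸ ht ▸ V.map a

theorem bijective_lin {a : Q.A} {i j : Q.V} (hs : Q.s a = i) (ht : Q.t a = j)
    (h : Function.Bijective (V.map a)) : Function.Bijective (V.lin a hs ht) := by
  subst hs ht
  exact h

theorem Hom.app_lin (f : Hom V W) {a : Q.A} {i j : Q.V} (hs : Q.s a = i) (ht : Q.t a = j)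
    (x : V.M i) : f.app j (V.lin a hs ht x) = W.lin a hs ht (f.app i x) := by
  subst hs ht
  exact (LinearMap.congr_fun (f.comm a) x).symm

theorem map_mem_of_lin_mem {S : ∀ i, Submodule F (V.M i)} {a : Q.A} {i j : Q.V} (hs : Q.s a = i)
    (ht : Q.t a = j) (h : ∀ x ∈ S i, V.lin a hs ht x ∈ S j) :
    ∀ x ∈ S (Q.s a), V.map a x ∈ S (Q.t a) := by
  subst hs ht
  exact h

theorem iso_dsum_of_isCompl (S T : Subrep V) (hc : ∀ i, IsCompl (S.S i) (T.S i)) :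
    Iso V (dsum S.toRep T.toRep) := by
  refine ⟨⟨fun i => ((S.S i).prodEquivOfIsCompl (T.S i) (hc i)).symm.toLinearMap, fun a => ?_⟩,
    fun i => ((S.S i).prodEquivOfIsCompl (T.S i) (hc i)).symm.bijective⟩
  refine LinearMap.ext fun x => ?_
  obtain ⟨⟨p, q⟩, rfl⟩ := ((S.S _).prodEquivOfIsCompl (T.S _) (hc (Q.s a))).surjective x
  refine (LinearEquiv.eq_symm_apply _).2 ?_
  have h1 : ((S.S _).prodEquivOfIsCompl (T.S _) (hc (Q.s a))).symm
      (((S.S _).prodEquivOfIsCompl (T.S _) (hc (Q.s a))) (p, q)) = (p, q) :=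
    LinearEquiv.symm_apply_apply _ _
  change ((S.S _).prodEquivOfIsCompl (T.S _) (hc (Q.t a))) ((dsum S.toRep T.toRep).map a
    (((S.S _).prodEquivOfIsCompl (T.S _) (hc (Q.s a))).symm
      (((S.S _).prodEquivOfIsCompl (T.S _) (hc (Q.s a))) (p, q)))) = _
  rw [h1]
  change V.map a p.1 + V.map a q.1 = V.map a (p.1 + q.1)
  rw [map_add]

theorem Indec.eq_bot_or (hV : V.Indec) (S T : Subrep V) (hc : ∀ i, IsCompl (S.S i) (T.S i)) :
    (∀ i, S.S i = ⊥) ∨ ∀ i, T.S i = ⊥ := by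
  have key : ∀ S : Subrep V, ¬ (∀ i, S.S i = ⊥) → S.toRep.Nonzero := by
    intro S hS
    push Not at hS
    obtain ⟨i, hi⟩ := hS
    obtain ⟨x, hx, hx0⟩ := Submodule.exists_mem_ne_zero_of_ne_bot hi
    exact ⟨i, ⟨x, hx⟩, fun h => hx0 (congrArg Subtype.val h)⟩
  by_contra! hcon
  exact hV.2 _ _ (key S (not_forall.2 hcon.1)) (key T (not_forall.2 hcon.2))
    (iso_dsum_of_isCompl S T hc)

end General

section Relations

variable {F : Type} [Field F] {o : DE → Bool}

/-- The edges oriented away from the trivalent vertex. -/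
def outSet (o : DE → Bool) : Set DE := {e | (Dinf o).s e = e.par}

theorem target_of_mem {e : DE} (he : e ∈ outSet o) : (Dinf o).t e = e.child := by
  cases e <;> simp_all [outSet, Dinf, DE.endA, DE.endB, DE.par, DE.child]

theorem source_of_notMem {e : DE} (he : e ∉ outSet o) : (Dinf o).s e = e.child := by
  cases e <;> simp_all [outSet, Dinf, DE.endA, DE.endB, DE.par, DE.child]

theorem target_of_notMem {e : DE} (he : e ∉ outSet o) : (Dinf o).t e = e.par := by
  cases e <;> simp_all [outSet, Dinf, DE.endA, DE.endB, DE.par]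

/-- The spaces of a representation of the `D∞` quiver. -/
def space (V : QRep F (Dinf o)) (i : DV) : Type := V.M i

instance (V : QRep F (Dinf o)) (i : DV) : AddCommGroup (V.space i) := V.acg i

instance (V : QRep F (Dinf o)) (i : DV) : Module F (V.space i) := V.mod i

/-- The map of an edge oriented away from the trivalent vertex. -/
def outMap (V : QRep F (Dinf o)) {e : DE} (h : e ∈ outSet o) :
    V.space e.par →ₗ[F] V.space e.child :=
  lin (Q := Dinf o) V e h (target_of_mem h)

/-- The map of an edge oriented towards the trivalent vertex. -/
def inMap (V : QRep F (Dinf o)) {e : DE} (h : e ∉ outSet o) :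
    V.space e.child →ₗ[F] V.space e.par :=
  lin (Q := Dinf o) V e (source_of_notMem h) (target_of_notMem h)

open Classical in
/-- The maps of a representation as linear relations directed away from the trivalent vertex. -/
noncomputable def edgeRel (V : QRep F (Dinf o)) (e : DE) :
    Submodule F (V.space e.par × V.space e.child) :=
  if h : e ∈ outSet o then LinearMap.graph (V.outMap h)
  else (LinearMap.graph (V.inMap h)).comap
    (LinearEquiv.prodComm F (V.space e.par) (V.space e.child)).toLinearMap

variable {V W : QRep F (Dinf o)}

theorem mem_edgeRel_of_mem {e : DE} (h : e ∈ outSet o) {p : V.space e.par} {c : V.space e.child} :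
    (p, c) ∈ V.edgeRel e ↔ c = V.outMap h p := by
  rw [edgeRel, dif_pos h, LinearMap.mem_graph_iff]

theorem mem_edgeRel_of_notMem {e : DE} (h : e ∉ outSet o) {p : V.space e.par}
    {c : V.space e.child} : (p, c) ∈ V.edgeRel e ↔ p = V.inMap h c := by
  rw [edgeRel, dif_neg h]
  exact LinearMap.mem_graph_iff _ (x := (c, p))

theorem isArrowRel_edgeRel : IsArrowRel (outSet o) V.edgeRel where
  total _ he _ := ⟨_, (mem_edgeRel_of_mem he).2 rfl⟩
  single _ he _ hc := ((mem_edgeRel_of_mem he).1 hc).trans (map_zero _)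
  onto _ he _ := ⟨_, (mem_edgeRel_of_notMem he).2 rfl⟩
  inj _ he _ hp := ((mem_edgeRel_of_notMem he).1 hp).trans (map_zero _)

theorem goodEdge_edgeRel {e : DE} (h : Function.Bijective (V.map e)) :
    GoodEdge V.edgeRel e := by
  by_cases he : e ∈ outSet o
  · refine ⟨fun c => ?_, isArrowRel_edgeRel.single e he⟩
    have hb : Function.Bijective (V.outMap he) := bijective_lin (Q := Dinf o) _ _ h
    obtain ⟨p, hp⟩ := hb.2 c
    exact ⟨p, (mem_edgeRel_of_mem he).2 hp.symm⟩
  · have hb : Function.Bijective (V.inMap he) := bijective_lin (Q := Dinf o) _ _ h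
    exact ⟨isArrowRel_edgeRel.onto e he, fun c hc =>
      hb.1 (((mem_edgeRel_of_notMem he).1 hc).symm.trans (map_zero _).symm)⟩

theorem ArrowStable.map_mem {S : ∀ i, Submodule F (V.space i)}
    (hS : ArrowStable (outSet o) V.edgeRel S) (a : DE) :
    ∀ x ∈ (S ((Dinf o).s a) : Submodule F (V.M ((Dinf o).s a))),
      V.map a x ∈ (S ((Dinf o).t a) : Submodule F (V.M ((Dinf o).t a))) := by
  by_cases he : a ∈ outSet o
  · exact map_mem_of_lin_mem (S := S) he (target_of_mem he) fun x hx =>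
      (hS a x _ ((mem_edgeRel_of_mem he).2 rfl)).1 he hx
  · exact map_mem_of_lin_mem (S := S) (source_of_notMem he) (target_of_notMem he) fun x hx =>
      (hS a _ x ((mem_edgeRel_of_notMem he).2 rfl)).2 he hx

theorem Indec.arrowIndec (hV : V.Indec) : ArrowIndec (outSet o) V.edgeRel :=
  fun S T hc hS hT => hV.eq_bot_or ⟨S, ArrowStable.map_mem hS⟩ ⟨T, ArrowStable.map_mem hT⟩ hc

/-- The components of a morphism between representations of the `D∞` quiver. -/
def Hom.component (f : Hom V W) (i : DV) : V.space i →ₗ[F] W.space i := f.app i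

theorem Hom.component_mem_edgeRel (f : Hom V W) (e : DE) (p : V.space e.par)
    (c : V.space e.child) (h : (p, c) ∈ V.edgeRel e) :
    (f.component e.par p, f.component e.child c) ∈ W.edgeRel e := by
  by_cases he : e ∈ outSet o
  · rw [mem_edgeRel_of_mem he] at h ⊢
    rw [h]
    exact f.app_lin he (target_of_mem he) p
  · rw [mem_edgeRel_of_notMem he] at h ⊢
    rw [h]
    exact f.app_lin (source_of_notMem he) (target_of_notMem he) c

theorem exists_forall_mem_outSet (hout : (Dinf o).EventuallyOutward) :
    ∃ K, ∀ n ≥ K, .el n ∈ outSet o := by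
  let j : Journey (Dinf o) :=
    { len := ⊤
      vert := DV.long
      edge := fun k _ => DE.el k
      inj := fun _ _ _ _ h => DV.long.inj h
      adj := fun k _ => by
        by_cases he : .el k ∈ outSet o
        · exact Or.inl ⟨he, target_of_mem he⟩
        · exact Or.inr ⟨source_of_notMem he, target_of_notMem he⟩ }
  obtain ⟨B, hB⟩ := (hout j).bddAbove
  refine ⟨B + 1, fun n hn => ?_⟩
  by_contra he
  have := hB (show n ∈ _ from ⟨ENat.natCast_lt_top n, source_of_notMem he, target_of_notMem he⟩)
  omega

theorem exists_isRoot_edgeRel {K : ℕ} (hK : ∀ n ≥ K, .el n ∈ outSet o) (hV : V.Indec)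
    (hfl : V.IsFLEI) : ∃ r, IsRoot V.edgeRel r := by
  refine exists_isRoot isArrowRel_edgeRel hV.arrowIndec hK ?_ hV.1
  exact hfl.2.subset fun e he hb => he (goodEdge_edgeRel hb)

end Relations

end QRep

/-- For any eventually outward orientation of the `D∞` quiver, there is
no infinite sequence of indecomposable FLEI representations connected by morphisms each
of which is nonzero and not an isomorphism. -/
theorem stmt12 (F : Type) [Field F] (o : DE → Bool)
    (hout : (Dinf o).EventuallyOutward) :
    ¬ ∃ (W : ℕ → QRep F (Dinf o)) (f : ∀ n : ℕ, QRep.Hom (W n) (W (n + 1))),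
        (∀ n, (W n).Indec ∧ (W n).IsFLEI) ∧ (∀ n, (f n).Nonzero ∧ ¬ (f n).IsIso) := by
  rintro ⟨W, f, hW, hf⟩
  obtain ⟨K, hK⟩ := QRep.exists_forall_mem_outSet hout
  choose r hr using fun n => QRep.exists_isRoot_edgeRel hK (hW n).1 (hW n).2
  have hlt : ∀ n, rootMeasure (QRep.outSet o) K (W (n + 1)).edgeRel (r (n + 1)) <
      rootMeasure (QRep.outSet o) K (W n).edgeRel (r n) := fun n =>
    rootMeasure_lt (f n).component_mem_edgeRel QRep.isArrowRel_edgeRel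
      QRep.isArrowRel_edgeRel (hW n).1.arrowIndec (hW (n + 1)).1.arrowIndec hK (hr n)
      (hr (n + 1)) (hf n).1 (hf n).2
  exact not_strictAnti_of_wellFoundedLT
    (fun n => rootMeasure (QRep.outSet o) K (W n).edgeRel (r n)) (strictAnti_nat_of_succ_lt hlt)
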